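/- There exists an absolute constant C > 0 such that the following holds for every prime p and positive integer k, setting q = p^k. Assume that no nonprincipal Dirichlet character modulo q has a real zero β with β ≥ 1 − c0/log q (nonexistence of the exceptional zero, where c0 is the constant of the classical zero-free region). Then |Σ_{χ ≠ χ0, χ(−1)=1} (f_χ · |L(1,χ)|^2)^{−1} − (ζ(2)/(2ζ(4))) · ((p−1)^2/(p^2+1)) · k| ≤ C·(1/log p) + C·k^2 (log p)^2 (log k + log log p)^2 / p. -/

import Mathlib

open Complex DirichletCharacter

namespace NSM
open MeasureTheory Set Filter Topology

noncomputable def S {N : ℕ} (χ : DirichletCharacter ℂ N) (t : ℝ) : ℂ :=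
  ∑ n ∈ Finset.Icc 1 ⌊t⌋₊, χ (n : ZMod N)

lemma S_le_self {N : ℕ} (χ : DirichletCharacter ℂ N) {t : ℝ} (ht : 0 ≤ t) : ‖S χ t‖ ≤ t := by
  unfold S
  calc ‖∑ n ∈ Finset.Icc 1 ⌊t⌋₊, χ (n : ZMod N)‖ ≤ ∑ n ∈ Finset.Icc 1 ⌊t⌋₊, (1:ℝ) :=
        norm_sum_le_of_le _ fun n _ => χ.norm_le_one _
    _ = ⌊t⌋₊ := by simp
    _ ≤ t := Nat.floor_le ht

lemma sum_period {N : ℕ} [NeZero N] {χ : DirichletCharacter ℂ N} (hχ : χ ≠ 1) (m : ℕ) :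
    ∑ n ∈ Finset.range (N * m), χ (n : ZMod N) = 0 := by
  have h1 : ∑ n ∈ Finset.range N, χ (n : ZMod N) = 0 := by
    rw [← MulChar.sum_eq_zero_of_ne_one hχ]
    refine Finset.sum_bij' (fun n _ => (n : ZMod N)) (fun a _ => a.val) ?_ ?_ ?_ ?_ ?_
    · simp
    · intro a _; simpa using ZMod.val_lt a
    · intro n hn; exact ZMod.val_cast_of_lt (by simpa using hn)
    · intro a _; simp
    · simp
  induction m with
  | zero => simp
  | succ m ih =>
    rw [Nat.mul_succ, Finset.sum_range_add, ih]
    simpa using h1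

lemma S_le_level {N : ℕ} [NeZero N] {χ : DirichletCharacter ℂ N} (hχ : χ ≠ 1) (t : ℝ) :
    ‖S χ t‖ ≤ N := by
  have hN : N ≠ 1 := fun h => hχ (level_one' χ h)
  have h0 : χ (0 : ZMod N) = 0 := χ.map_zero' hN
  unfold S
  set M := ⌊t⌋₊
  have h1 : ∑ n ∈ Finset.Icc 1 M, χ (n : ZMod N) = ∑ n ∈ Finset.range (M+1), χ (n : ZMod N) := by
    rw [Finset.range_eq_Ico, Finset.sum_eq_sum_Ico_succ_bot (by omega)]
    simp only [Nat.cast_zero, h0, zero_add]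
    rfl
  rw [h1, ← Nat.div_add_mod (M+1) N, Finset.sum_range_add, sum_period hχ, zero_add]
  calc _ ≤ ∑ n ∈ Finset.range ((M+1) % N), (1:ℝ) :=
        norm_sum_le_of_le _ fun n _ => χ.norm_le_one _
    _ = ((M+1) % N : ℕ) := by simp
    _ ≤ N := by exact_mod_cast (Nat.mod_lt _ (Nat.pos_of_ne_zero (NeZero.ne N))).le

lemma S_le {N : ℕ} [NeZero N] {χ : DirichletCharacter ℂ N} (hχ : χ ≠ 1) {t θ : ℝ} (ht : 0 < t)
    (h0 : 0 ≤ θ) (h1 : θ ≤ 1) : ‖S χ t‖ ≤ (N:ℝ) ^ θ * t ^ (1 - θ) := by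
  have hS := norm_nonneg (S χ t)
  calc ‖S χ t‖ = ‖S χ t‖ ^ θ * ‖S χ t‖ ^ (1 - θ) := by
        rcases hS.eq_or_lt with h | h
        · rw [← h]
          rcases h0.eq_or_lt with h' | h'
          · rw [← h']; simp
          · rw [Real.zero_rpow h'.ne']; simp
        · rw [← Real.rpow_add h]; simp
    _ ≤ _ := by
        gcongr
        · exact S_le_level hχ t
        · exact S_le_self χ ht.le

lemma S_measurable {N : ℕ} (χ : DirichletCharacter ℂ N) : Measurable (S χ) := by
  have : S χ = (fun n : ℕ => ∑ n ∈ Finset.Icc 1 n, χ (n : ZMod N)) ∘ (fun t : ℝ => ⌊t⌋₊) := rfl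
  rw [this]
  exact (measurable_from_top).comp Nat.measurable_floor

lemma S_zero {N : ℕ} (χ : DirichletCharacter ℂ N) {t : ℝ} (ht : t < 1) : S χ t = 0 := by
  unfold S
  have : ⌊t⌋₊ = 0 := Nat.floor_eq_zero.2 ht
  simp [this]

lemma L_repr {N : ℕ} [NeZero N] {χ : DirichletCharacter ℂ N} (hχ : χ ≠ 1) {s : ℂ}
    (hs : 0 < s.re) :
    LFunction χ s = s * ∫ t in Ioi (1:ℝ), S χ t * (t:ℂ) ^ (-(s + 1)) := by
  have hmel : ∀ s : ℂ, mellin (S χ) (-s) = ∫ t in Ioi (1:ℝ), S χ t * (t:ℂ) ^ (-(s + 1)) := by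
    intro s
    unfold mellin
    have : ∀ t ∈ Ioi (0:ℝ) \ Ici 1, (t:ℂ) ^ (-s - 1) • S χ t = 0 := by
      intro t ht
      rw [S_zero χ (by simpa using ht.2)]; simp
    rw [setIntegral_eq_of_subset_of_forall_sdiff_eq_zero measurableSet_Ioi
      (Ici_subset_Ioi.2 one_pos) this, integral_Ici_eq_integral_Ioi]
    refine setIntegral_congr_fun measurableSet_Ioi fun t _ => ?_
    simp only [smul_eq_mul]
    rw [mul_comm]; congr 2; ring
  rw [← hmel]
  have hloc : LocallyIntegrableOn (S χ) (Ioi 0) := by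
    refine LocallyIntegrable.locallyIntegrableOn ?_ _
    refine (locallyIntegrable_const (N:ℝ)).mono (S_measurable χ).aestronglyMeasurable ?_
    refine Eventually.of_forall fun t => ?_
    simpa using S_le_level hχ t
  have hdiff : ∀ s : ℂ, 0 < s.re → DifferentiableAt ℂ (fun s => s * mellin (S χ) (-s)) s := by
    intro s hs
    refine differentiableAt_id.mul ?_
    refine DifferentiableAt.comp (g := mellin (S χ)) (f := fun s => -s) s ?_ differentiableAt_id.neg
    refine mellin_differentiableAt_of_isBigO_rpow (a := 0) (b := (-s).re - 1) hloc ?_ (by simpa using hs) ?_ (by simp)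
    · simp only [neg_zero, Real.rpow_zero]
      refine Asymptotics.IsBigO.of_bound N (Eventually.of_forall fun t => ?_)
      simpa using S_le_level hχ t
    · refine Asymptotics.IsBigO.of_bound 1 ?_
      have : ∀ᶠ t : ℝ in 𝓝[>] 0, t < 1 := nhdsWithin_le_nhds (eventually_lt_nhds one_pos)
      filter_upwards [this] with t ht
      rw [S_zero χ ht]; simp
  have hopen : IsOpen {s : ℂ | 0 < s.re} := isOpen_lt continuous_const continuous_re
  have hf : AnalyticOnNhd ℂ (LFunction χ) {s : ℂ | 0 < s.re} :=
    (differentiable_LFunction hχ).differentiableOn.analyticOnNhd hopen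
  have hg : AnalyticOnNhd ℂ (fun s => s * mellin (S χ) (-s)) {s : ℂ | 0 < s.re} :=
    DifferentiableOn.analyticOnNhd (fun s hs => (hdiff s hs).differentiableWithinAt) hopen
  refine hf.eqOn_of_preconnected_of_eventuallyEq hg (convex_halfSpace_re_gt 0).isPreconnected
    (z₀ := 2) (by simp) ?_ hs
  have : ∀ᶠ z : ℂ in 𝓝 2, 1 < z.re :=
    (isOpen_lt continuous_const continuous_re).mem_nhds (by simp)
  filter_upwards [this] with z hz
  rw [LFunction_eq_LSeries χ hz, hmel]
  refine LSeries_eq_mul_integral _ (r := 0) le_rfl (by linarith)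
    (LSeriesSummable_of_one_lt_re χ hz) ?_
  simp only [Real.rpow_zero]
  refine Asymptotics.IsBigO.of_bound N (Eventually.of_forall fun n => ?_)
  have := S_le_level hχ (n:ℝ)
  unfold S at this
  simpa using this

lemma norm_integrand {t : ℝ} (ht : t ∈ Ioi (1:ℝ)) (s : ℂ) :
    ‖(t:ℂ) ^ (-(s+1))‖ = t ^ (-s.re - 1) := by
  rw [norm_cpow_eq_rpow_re_of_pos (by have := mem_Ioi.1 ht; linarith)]
  congr 1; simp; ring

lemma integral_aux {a : ℝ} (ha : 0 < a) : ∫ t in Ioi (1:ℝ), t ^ (-a - 1) = 1 / a := by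
  rw [integral_Ioi_rpow_of_lt (by linarith) one_pos]
  simp

lemma integrable_aux {a : ℝ} (ha : 0 < a) : IntegrableOn (fun t : ℝ => t ^ (-a - 1)) (Ioi 1) :=
  integrableOn_Ioi_rpow_of_lt (by linarith) one_pos

lemma S_meas' {N : ℕ} (χ : DirichletCharacter ℂ N) (s : ℂ) :
    AEStronglyMeasurable (fun t : ℝ => S χ t * (t:ℂ) ^ (-(s + 1))) (volume.restrict (Ioi 1)) := by
  refine (S_measurable χ).aestronglyMeasurable.mul ?_
  refine ContinuousOn.aestronglyMeasurable ?_ measurableSet_Ioi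
  intro t ht
  refine ContinuousAt.continuousWithinAt ?_
  exact continuousAt_ofReal_cpow_const _ _ (Or.inr (by have := mem_Ioi.1 ht; linarith))

lemma integrand_le {N : ℕ} [NeZero N] {χ : DirichletCharacter ℂ N} (hχ : χ ≠ 1) {s : ℂ} {θ : ℝ}
    (h0 : 0 ≤ θ) (h1 : θ ≤ 1) {t : ℝ} (ht : t ∈ Ioi (1:ℝ)) :
    ‖S χ t * (t:ℂ) ^ (-(s + 1))‖ ≤ (N:ℝ)^θ * t ^ (-(s.re - (1 - θ)) - 1) := by
  have ht0 : 0 < t := by have := mem_Ioi.1 ht; linarith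
  rw [norm_mul, norm_integrand ht]
  calc _ ≤ ((N:ℝ) ^ θ * t ^ (1 - θ)) * t ^ (-s.re - 1) := by
        gcongr; exact S_le hχ ht0 h0 h1
    _ = _ := by rw [mul_assoc, ← Real.rpow_add ht0]; congr 2; ring

lemma integrand_integrable {N : ℕ} [NeZero N] {χ : DirichletCharacter ℂ N} (hχ : χ ≠ 1) {s : ℂ}
    (hs : 0 < s.re) :
    IntegrableOn (fun t : ℝ => S χ t * (t:ℂ) ^ (-(s + 1))) (Ioi 1) := by
  refine Integrable.mono' ((integrable_aux hs).const_mul (N:ℝ)) (S_meas' χ s) ?_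
  refine (ae_restrict_mem measurableSet_Ioi).mono fun t ht => ?_
  simpa using integrand_le hχ (s := s) zero_le_one le_rfl ht

lemma norm_L_le {N : ℕ} [NeZero N] {χ : DirichletCharacter ℂ N} (hχ : χ ≠ 1) {s : ℂ} {θ : ℝ}
    (h0 : 0 ≤ θ) (h1 : θ ≤ 1) (hs : 1 - θ < s.re) :
    ‖LFunction χ s‖ ≤ ‖s‖ * ((N:ℝ)^θ / (s.re - (1 - θ))) := by
  rw [L_repr hχ (by linarith), norm_mul]
  gcongr
  calc _ ≤ ∫ t in Ioi (1:ℝ), (N:ℝ)^θ * t ^ (-(s.re - (1 - θ)) - 1) := by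
        refine norm_integral_le_of_norm_le ((integrable_aux (by linarith)).const_mul _) ?_
        exact (ae_restrict_mem measurableSet_Ioi).mono fun t ht => integrand_le hχ h0 h1 ht
    _ = _ := by rw [integral_const_mul, integral_aux (by linarith)]; ring

lemma L_diff {N : ℕ} [NeZero N] {χ : DirichletCharacter ℂ N} (hχ : χ ≠ 1) {θ δ : ℝ}
    (h0 : 0 < θ) (h1 : θ ≤ 1/2) (hδ : 0 ≤ δ) :
    ‖LFunction χ (1 + δ) - LFunction χ 1‖ ≤ δ * (2 / θ^2 * (N:ℝ)^(2*θ)) := by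
  have hre : ((1:ℂ) + δ).re = 1 + δ := by simp
  rw [L_repr hχ (s := 1 + δ) (by rw [hre]; linarith), L_repr hχ (s := 1) (by simp)]
  set I1 := ∫ t in Ioi (1:ℝ), S χ t * (t:ℂ) ^ (-((1 + δ : ℂ) + 1)) with hI1
  set I0 := ∫ t in Ioi (1:ℝ), S χ t * (t:ℂ) ^ (-((1 : ℂ) + 1)) with hI0
  have e : (1 + δ : ℂ) * I1 - 1 * I0 = δ * I1 + (I1 - I0) := by ring
  rw [e]
  have b1 : ‖I1‖ ≤ (N:ℝ)^(2*θ) / (2*θ) := by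
    calc _ ≤ ∫ t in Ioi (1:ℝ), (N:ℝ)^(2*θ) * t ^ (-(2*θ) - 1) := by
          refine norm_integral_le_of_norm_le ((integrable_aux (by linarith)).const_mul _) ?_
          refine (ae_restrict_mem measurableSet_Ioi).mono fun t ht => ?_
          refine (integrand_le hχ (θ := 2*θ) (by linarith) (by linarith) ht).trans ?_
          rw [hre]
          gcongr
          · exact (mem_Ioi.1 ht).le
          · linarith
      _ = _ := by rw [integral_const_mul, integral_aux (by linarith)]; ring
  have b2 : ‖I1 - I0‖ ≤ δ * ((N:ℝ)^(2*θ) / θ^2) := by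
    rw [hI1, hI0, ← integral_sub (integrand_integrable hχ (by rw [hre]; linarith))
      (integrand_integrable hχ (by simp))]
    calc _ ≤ ∫ t in Ioi (1:ℝ), (δ / θ * (N:ℝ)^(2*θ)) * t ^ (-θ - 1) := by
          refine norm_integral_le_of_norm_le ((integrable_aux (by linarith)).const_mul _) ?_
          refine (ae_restrict_mem measurableSet_Ioi).mono fun t ht => ?_
          have ht1 : 1 < t := ht
          have ht0 : 0 < t := by linarith
          have e1 : S χ t * (t:ℂ) ^ (-((1 + δ : ℂ) + 1)) - S χ t * (t:ℂ) ^ (-((1 : ℂ) + 1))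
              = S χ t * (t:ℂ) ^ (-((1 : ℂ) + 1)) * (((t ^ (-δ) - 1 : ℝ)) : ℂ) := by
            rw [ofReal_sub, ofReal_cpow ht0.le, mul_sub, mul_assoc, ← cpow_add _ _ (by exact_mod_cast ht0.ne')]
            simp; left; congr 1; ring
          rw [e1, norm_mul]
          have e2 : ‖(((t ^ (-δ) - 1 : ℝ)) : ℂ)‖ ≤ δ * (t^θ / θ) := by
            rw [norm_real, Real.norm_eq_abs, abs_le]
            have hl : Real.log t ≤ t^θ/θ := Real.log_le_rpow_div ht0.le h0
            have hle : 1 + Real.log t * (-δ) ≤ t ^ (-δ) := by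
              rw [Real.rpow_def_of_pos ht0]
              linarith [Real.add_one_le_exp (Real.log t * (-δ))]
            have hu : t ^ (-δ) ≤ 1 := Real.rpow_le_one_of_one_le_of_nonpos ht1.le (by linarith)
            have : δ * Real.log t ≤ δ * (t^θ/θ) := by gcongr
            have h3 : 0 ≤ δ * (t^θ/θ) := by positivity
            constructor <;> linarith
          calc _ ≤ ((N:ℝ)^(2*θ) * t ^ (-((1:ℂ).re - (1 - 2*θ)) - 1)) * (δ * (t^θ / θ)) := by
                gcongr
                exact integrand_le hχ (by linarith) (by linarith) ht
            _ = (δ / θ * (N:ℝ)^(2*θ)) * (t ^ (-((1:ℂ).re - (1 - 2*θ)) - 1) * t^θ) := by ring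
            _ = _ := by rw [← Real.rpow_add ht0]; simp; left; congr 1; ring
      _ = _ := by rw [integral_const_mul, integral_aux (by linarith)]; field_simp
  calc _ ≤ ‖(δ:ℂ) * I1‖ + ‖I1 - I0‖ := norm_add_le _ _
    _ ≤ δ * ((N:ℝ)^(2*θ) / (2*θ)) + δ * ((N:ℝ)^(2*θ) / θ^2) := by
        rw [norm_mul, norm_real, Real.norm_of_nonneg hδ]; gcongr
    _ = δ * (N:ℝ)^(2*θ) * (1 / (2*θ) + 1/θ^2) := by ring
    _ ≤ δ * (N:ℝ)^(2*θ) * (2/θ^2) := by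
        gcongr
        have : 1 / (2*θ) ≤ 1/θ^2 := by
          apply one_div_le_one_div_of_le (by positivity); nlinarith
        have h2 : 2 / θ^2 = 1/θ^2 + 1/θ^2 := by ring
        linarith
    _ = _ := by ring

end NSM

namespace NSM
open MeasureTheory Set Filter Topology

lemma step_aux {x : ℝ} (hx : 0 < x) (M : ℕ) :
    ((M:ℝ) + 2) ^ (-1 - x) ≤ (((M:ℝ)+1) ^ (-x) - ((M:ℝ)+2)^(-x)) / x := by
  have h2 : (0:ℝ) < (M:ℝ) + 2 := by positivity
  have h1 : (0:ℝ) < (M:ℝ) + 1 := by positivity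
  have hr : ((M:ℝ)+1) ^ (-x) = ((M:ℝ)+2)^(-x) * (((M:ℝ)+1)/(M+2)) ^ (-x) := by
    rw [← Real.mul_rpow h2.le (by positivity)]; congr 1; field_simp
  have hb : 1 + x / (M+2) ≤ (((M:ℝ)+1)/(M+2)) ^ (-x) := by
    rw [Real.rpow_def_of_pos (by positivity)]
    have hl : Real.log (((M:ℝ)+1)/(M+2)) ≤ ((M:ℝ)+1)/(M+2) - 1 := Real.log_le_sub_one_of_pos (by positivity)
    have he : ((M:ℝ)+1)/(M+2) - 1 = - (1 / (M+2)) := by field_simp; ring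
    have := Real.add_one_le_exp (Real.log (((M:ℝ)+1)/(M+2)) * -x)
    have h3 : x / (M+2) ≤ Real.log (((M:ℝ)+1)/(M+2)) * -x := by
      rw [he] at hl
      have : x * Real.log (((M:ℝ)+1)/(M+2)) ≤ x * (- (1 / (M+2))) := by gcongr
      have e : x / ((M:ℝ)+2) = x * (1 / (M+2)) := by ring
      rw [e]; linarith
    linarith
  rw [hr, le_div_iff₀ hx]
  have e : ((M:ℝ) + 2) ^ (-1 - x) = ((M:ℝ)+2)^(-x) * (1 / (M+2)) := by
    rw [show -1 - x = -x + (-1) by ring, Real.rpow_add h2, Real.rpow_neg_one]; ring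
  rw [e]
  have hp : 0 < ((M:ℝ)+2)^(-x) := by positivity
  have := mul_le_mul_of_nonneg_left hb hp.le
  have e2 : ((M:ℝ)+2)^(-x) * (1 + x / (M+2)) = ((M:ℝ)+2)^(-x) + ((M:ℝ)+2)^(-x) * (1 / (M+2)) * x := by ring
  linarith

lemma zsum_range {x : ℝ} (hx : 0 < x) (M : ℕ) :
    ∑ n ∈ Finset.range M, ((n:ℝ) + 1) ^ (-1 - x) ≤ 1 + 1 / x := by
  have : ∀ M : ℕ, ∑ n ∈ Finset.range (M+1), ((n:ℝ) + 1) ^ (-1 - x)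
      ≤ 1 + (1 - ((M:ℝ)+1)^(-x)) / x := by
    intro M
    induction M with
    | zero => simp
    | succ M ih =>
      rw [Finset.sum_range_succ]
      have := step_aux hx M
      push_cast
      rw [show (M:ℝ) + 1 + 1 = M + 2 by ring]
      have e : 1 + (1 - ((M:ℝ)+2)^(-x)) / x = 1 + (1 - ((M:ℝ)+1)^(-x)) / x +
        (((M:ℝ)+1) ^ (-x) - ((M:ℝ)+2)^(-x)) / x := by ring
      rw [e]; linarith
  rcases M with _ | M
  · simp; positivity
  · refine (this M).trans ?_
    have : 0 ≤ ((M:ℝ)+1)^(-x) := by positivity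
    gcongr; linarith

lemma zsummable {x : ℝ} (hx : 0 < x) : Summable fun n : ℕ => ((n:ℝ) + 1) ^ (-1 - x) :=
  summable_of_sum_range_le (fun n => by positivity) (zsum_range hx)

lemma ztsum {x : ℝ} (hx : 0 < x) : ∑' n : ℕ, ((n:ℝ) + 1) ^ (-1 - x) ≤ 1 + 1 / x :=
  Real.tsum_le_of_sum_range_le (fun n => by positivity) (zsum_range hx)

lemma zsummable0 {x : ℝ} (hx : 0 < x) : Summable fun n : ℕ => (n:ℝ) ^ (-1 - x) :=
  Real.summable_nat_rpow.2 (by linarith)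

lemma ztsum0 {x : ℝ} (hx : 0 < x) : ∑' n : ℕ, (n:ℝ) ^ (-1 - x) ≤ 1 + 1 / x := by
  rw [(zsummable0 hx).tsum_eq_zero_add]
  rw [Nat.cast_zero, Real.zero_rpow (by linarith), zero_add]
  exact_mod_cast ztsum hx

lemma LSeries_bound {f : ℕ → ℂ} (hf : ∀ n, ‖f n‖ ≤ 1) {x : ℝ} (hx : 0 < x) :
    ‖LSeries f (1 + x)‖ ≤ 1 + 1 / x := by
  have hle : ∀ n, ‖LSeries.term f (1 + x) n‖ ≤ (n:ℝ) ^ (-1 - x) := by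
    intro n
    rcases eq_or_ne n 0 with rfl | hn
    · simp; positivity
    · rw [LSeries.term_of_ne_zero hn, norm_div, norm_natCast_cpow_of_pos (Nat.pos_of_ne_zero hn)]
      have : -1 - x = -(1 + x : ℂ).re := by simp; ring
      rw [this, Real.rpow_neg (by positivity), div_eq_mul_inv]
      exact mul_le_of_le_one_left (by positivity) (hf n)
  unfold LSeries
  exact (tsum_of_norm_bounded (zsummable0 hx).hasSum hle).trans (ztsum0 hx)

lemma LFunction_bound {N : ℕ} [NeZero N] (χ : DirichletCharacter ℂ N) {x : ℝ} (hx : 0 < x) :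
    ‖LFunction χ (1 + x)‖ ≤ 1 + 1 / x := by
  rw [LFunction_eq_LSeries χ (by simpa using hx)]
  exact LSeries_bound (fun n => χ.norm_le_one _) hx

/-- small exponent -/
noncomputable def aa : ℝ := 1 / 240

/-- `N ^ aa` -/
noncomputable def BB (N : ℕ) : ℝ := (N:ℝ) ^ aa

lemma BB_ge_one (N : ℕ) [NeZero N] : 1 ≤ BB N := by
  unfold BB aa
  refine Real.one_le_rpow ?_ (by norm_num)
  exact_mod_cast Nat.one_le_iff_ne_zero.2 (NeZero.ne N)

lemma L_diff' {N : ℕ} [NeZero N] {χ : DirichletCharacter ℂ N} (hχ : χ ≠ 1) {δ : ℝ} (hδ : 0 ≤ δ) :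
    ‖LFunction χ (1 + δ) - LFunction χ 1‖ ≤ δ * (2 / aa^2 * BB N ^ 2) := by
  have := L_diff hχ (θ := aa) (by norm_num [aa]) (by norm_num [aa]) hδ
  have e : (N:ℝ)^(2*aa) = BB N ^ 2 := by
    unfold BB
    rw [← Real.rpow_natCast, ← Real.rpow_mul (by positivity)]; congr 1; push_cast; ring
  rwa [e] at this

lemma LB : ∃ c > (0:ℝ), ∀ (N : ℕ) [NeZero N] (χ : DirichletCharacter ℂ N), χ ^ 2 ≠ 1 →
    c / BB N ^ 7 ≤ ‖LFunction χ 1‖ := by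
  have ha : 0 < aa := by norm_num [aa]
  have ha1 : aa ≤ 1 := by norm_num [aa]
  set κ : ℝ := aa ^ 9 / 8192 with hκ
  have hκ0 : 0 < κ := by positivity
  have hκ1 : κ ≤ 1 := by
    rw [hκ]
    have : aa ^ 9 ≤ 1 := pow_le_one₀ ha.le ha1
    linarith
  refine ⟨κ * (2 / aa^2), by positivity, ?_⟩
  intro N _ χ hχ2
  have hχ : χ ≠ 1 := by rintro rfl; simp at hχ2
  have hB := BB_ge_one N
  have hB0 : 0 < BB N := by linarith
  set B := BB N with hBd
  set x : ℝ := κ / B ^ 9 with hx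
  have hx0 : 0 < x := by positivity
  have hx1 : x ≤ 1 := by
    rw [hx, div_le_one (by positivity)]
    exact hκ1.trans (one_le_pow₀ hB)
  set y : ℝ := x * (2 / aa^2 * B^2) with hy
  have hgoal : κ * (2 / aa^2) / B ^ 7 = y := by
    rw [hy, hx]; field_simp
  rw [hgoal]
  by_contra! hlt
  have hD := L_diff' hχ hx0.le
  have h1 : ‖LFunction χ (1 + x)‖ ≤ 2 * y := by
    have := norm_sub_norm_le (LFunction χ (1 + x)) (LFunction χ 1)
    linarith
  have h341 := norm_LFunction_product_ge_one χ hx0 0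
  simp only [ofReal_zero, mul_zero, add_zero, norm_mul, norm_pow] at h341
  have ht : ‖LFunctionTrivChar N (1 + x)‖ ≤ 2 / x := by
    refine (LFunction_bound _ hx0).trans ?_
    rw [show (2:ℝ)/x = 1/x + 1/x by ring]
    gcongr
    rw [le_div_iff₀ hx0]; linarith
  have h2 : ‖LFunction (χ^2) (1 + x)‖ ≤ 2 * (B / aa) := by
    have hre : ((1:ℂ) + x).re = 1 + x := by simp
    refine (norm_L_le hχ2 (θ := aa) ha.le ha1 (by rw [hre]; linarith)).trans ?_
    have hn : ‖(1:ℂ) + x‖ ≤ 2 := by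
      refine (norm_add_le _ _).trans ?_
      rw [norm_one, norm_real, Real.norm_of_nonneg hx0.le]; linarith
    rw [hre]
    have : (N:ℝ)^aa = B := rfl
    rw [this]
    have h3 : B / (1 + x - (1 - aa)) ≤ B / aa := by
      gcongr; linarith
    exact mul_le_mul hn h3 (div_nonneg hB0.le (by linarith)) (by norm_num)
  have hfin : 1 ≤ (2/x)^3 * (2*y)^4 * (2 * (B/aa)) := by
    refine h341.le.trans ?_
    gcongr
  have hval : (2/x)^3 * (2*y)^4 * (2 * (B/aa)) = 1/2 := by
    have : x * B^9 = κ := by rw [hx]; field_simp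
    have e : (2/x)^3 * (2*y)^4 * (2 * (B/aa)) = 4096 * (x * B^9) / aa^9 := by
      rw [hy]; field_simp; ring
    rw [e, this, hκ]; field_simp; norm_num
  linarith

lemma inv_sq_diff {u v m D : ℝ} (hm : 0 < m) (hu : m ≤ u) (hv : m ≤ v) (hD : |v - u| ≤ D) :
    |1 / u^2 - 1 / v^2| ≤ 2 * D / m^3 := by
  have hu0 : 0 < u := by linarith
  have hv0 : 0 < v := by linarith
  have hD0 : 0 ≤ D := (abs_nonneg _).trans hD
  have e : 1 / u^2 - 1 / v^2 = (v - u) * (1 / (u^2 * v) + 1 / (u * v^2)) := by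
    field_simp; ring
  rw [e, abs_mul, abs_of_nonneg (a := 1 / (u^2 * v) + 1 / (u * v^2)) (by positivity)]
  have h1 : 1 / (u^2 * v) ≤ 1 / m^3 := by
    apply one_div_le_one_div_of_le (by positivity)
    calc m^3 = m^2 * m := by ring
      _ ≤ _ := by gcongr
  have h2 : 1 / (u * v^2) ≤ 1 / m^3 := by
    apply one_div_le_one_div_of_le (by positivity)
    calc m^3 = m * m^2 := by ring
      _ ≤ _ := by gcongr
  calc _ ≤ D * (1/m^3 + 1/m^3) := by gcongr
    _ = _ := by ring

lemma MD : ∃ κ > (0:ℝ), κ ≤ 1 ∧ ∃ C > (0:ℝ), ∀ (N : ℕ) [NeZero N] (χ : DirichletCharacter ℂ N), χ ^ 2 ≠ 1 →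
    |1 / ‖LFunction χ 1‖ ^ 2 - 1 / ‖LFunction χ (1 + (κ / BB N ^ 24 : ℝ))‖ ^ 2| ≤ C / BB N := by
  obtain ⟨c, hc, hLB⟩ := LB
  have ha : 0 < aa := by norm_num [aa]
  set κ : ℝ := min 1 (c * aa^2 / 4) with hκ
  have hκ0 : 0 < κ := by positivity
  refine ⟨κ, hκ0, min_le_left _ _, 2 * κ * (2/aa^2) * 8 / c^3, by positivity, ?_⟩
  intro N _ χ hχ2
  have hχ : χ ≠ 1 := by rintro rfl; simp at hχ2
  have hB := BB_ge_one N
  have hB0 : 0 < BB N := by linarith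
  have h1 := hLB N χ hχ2
  have hD := L_diff' hχ (δ := κ / BB N ^ 24) (by positivity)
  set B := BB N
  set m : ℝ := c / (2 * B^7) with hm
  have hDm : κ / B^24 * (2 / aa^2 * B^2) ≤ m := by
    have hk2 : κ ≤ c * aa^2/4 := min_le_right _ _
    calc κ / B^24 * (2 / aa^2 * B^2) ≤ (c * aa^2/4) / B^24 * (2 / aa^2 * B^2) := by gcongr
      _ = c / (2 * B^22) := by field_simp; ring
      _ ≤ m := by
        rw [hm]
        gcongr <;> norm_num
  have hmm : c / B^7 = m + m := by rw [hm]; field_simp; ring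
  have hm0 : 0 < m := by positivity
  have hsub := norm_sub_norm_le (LFunction χ 1) (LFunction χ (1 + (κ / B ^ 24 : ℝ)))
  rw [norm_sub_rev] at hsub
  refine (inv_sq_diff hm0 (by linarith) (by linarith) ((abs_norm_sub_norm_le _ _).trans hD)).trans ?_
  apply le_of_eq
  rw [hm]; field_simp; norm_num

end NSM

namespace NSM
open scoped ComplexOrder
open MeasureTheory Set Filter Topology

lemma taylor_ineq {e : ℕ → ℝ} {η g l K : ℝ} {M : ℕ} (hη : 0 < η) (hη1 : η ≤ 1/10) (hM : 1 ≤ M)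
    (hs : HasSum (fun m => (1 + η)^m * e m) g) (h0 : 1 - l ≤ e 0) (h1 : ∀ m, -l ≤ e m)
    (hK : ∀ m, |e m| ≤ K * (2/3)^m) (hg : g ≤ l / η) (htail : 4 * K * (3/4)^M ≤ 1/2) :
    1/2 ≤ l * (1 + η)^M / η := by
  have hK0 : 0 ≤ K := by simpa using (abs_nonneg _).trans (hK 0)
  have h2 : ∀ m, |(1+η)^m * e m| ≤ K * (3/4)^m := by
    intro m
    rw [abs_mul, abs_of_nonneg (by positivity)]
    calc (1+η)^m * |e m| ≤ (11/10)^m * (K * (2/3)^m) := by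
          gcongr
          · linarith
          · exact hK m
      _ = K * (11/15)^m := by rw [mul_left_comm, ← mul_pow]; norm_num
      _ ≤ _ := mul_le_mul_of_nonneg_left (pow_le_pow_left₀ (by norm_num) (by norm_num) m) hK0
  have hsum := hs.summable.sum_add_tsum_nat_add M
  rw [hs.tsum_eq] at hsum
  have ht : |∑' i, (1+η)^(i+M) * e (i+M)| ≤ 4 * K * (3/4)^M := by
    have hg4 : HasSum (fun i : ℕ => (3/4:ℝ)^i) 4 := by
      have := hasSum_geometric_of_lt_one (r := (3/4:ℝ)) (by norm_num) (by norm_num)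
      norm_num at this; exact this
    have : HasSum (fun i => K * (3/4:ℝ)^(i+M)) (4 * K * (3/4)^M) := by
      convert! hg4.mul_left (K * (3/4)^M) using 1
      · funext i; rw [pow_add]; ring
      · ring
    exact tsum_of_norm_bounded (f := fun i => (1+η)^(i+M) * e (i+M)) this (fun i => h2 (i+M))
  have h3 : 1 - l * (((1+η)^M - 1)/η) ≤ ∑ m ∈ Finset.range M, (1+η)^m * e m := by
    have hgeo : ∑ m ∈ Finset.range M, (1+η)^m = ((1+η)^M - 1)/η := by
      rw [geom_sum_eq (by linarith)]; simp
    rw [← hgeo, Finset.mul_sum]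
    obtain ⟨M', rfl⟩ : ∃ M', M = M' + 1 := ⟨M-1, by omega⟩
    rw [Finset.sum_range_succ', Finset.sum_range_succ']
    have : ∑ k ∈ Finset.range M', -(l * (1+η)^(k+1)) ≤ ∑ k ∈ Finset.range M', (1+η)^(k+1) * e (k+1) := by
      refine Finset.sum_le_sum fun k _ => ?_
      nlinarith [h1 (k+1), show 0 < (1+η)^(k+1) by positivity]
    rw [Finset.sum_neg_distrib] at this
    simp only [pow_zero, one_mul, mul_one]
    linarith
  have h4 := (abs_le.1 ht).1
  have h5 : 1/2 - l * (((1+η)^M - 1)/η) ≤ l/η := by linarith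
  have : l * (1 + η)^M / η = l * (((1+η)^M - 1)/η) + l / η := by ring
  linarith

/-- `(s-1) ζ(s)` as an entire function. -/
noncomputable def Z : ℂ → ℂ := Function.update (fun s => (s - 1) * riemannZeta s) 1 1

lemma Z_one : Z 1 = 1 := by simp [Z]

lemma Z_ne {s : ℂ} (hs : s ≠ 1) : Z s = (s - 1) * riemannZeta s := by simp [Z, hs]

lemma Z_diff : Differentiable ℂ Z := by
  intro s
  have hne : ∀ s : ℂ, s ≠ 1 → DifferentiableAt ℂ Z s := by
    intro s hs
    apply DifferentiableAt.congr_of_eventuallyEq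
    · exact (differentiableAt_id.sub_const 1).mul (differentiableAt_riemannZeta hs)
    · filter_upwards [eventually_ne_nhds hs] with t ht using Z_ne ht
  rcases ne_or_eq s 1 with hs | rfl
  · exact hne s hs
  refine (analyticAt_of_differentiable_on_punctured_nhds_of_continuousAt ?_ ?_).differentiableAt
  · filter_upwards [self_mem_nhdsWithin] with t ht
    exact hne t ht
  · simpa only [Z, continuousAt_update_same] using riemannZeta_residue_one

lemma zetaL {N : ℕ} [NeZero N] (χ : DirichletCharacter ℂ N) {s : ℂ} (hs : 1 < s.re) :
    riemannZeta s * LFunction χ s = LSeries χ.zetaMul s := by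
  rw [zetaMul, ← ArithmeticFunction.coe_mul, LSeries_convolution']
  · rw [χ.LFunction_eq_LSeries hs]
    congr 1
    · simp_rw [← ArithmeticFunction.LSeries_zeta_eq_riemannZeta hs, ← ArithmeticFunction.natCoe_apply]
    · exact LSeries_congr χ.apply_eq_toArithmeticFunction_apply s
  · exact ArithmeticFunction.LSeriesSummable_zeta_iff.mpr hs
  · exact (LSeriesSummable_congr _ fun h ↦ (χ.apply_eq_toArithmeticFunction_apply h).symm).mpr <|
      ZMod.LSeriesSummable_of_one_lt_re χ hs

lemma L_real {N : ℕ} [NeZero N] {χ : DirichletCharacter ℂ N} (hχ : χ ≠ 1) (h2 : χ^2 = 1) {x : ℝ}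
    (hx : 0 < x) : LFunction χ x = ((LFunction χ x).re : ℂ) := by
  have hS : ∀ t, S χ t = ((S χ t).re : ℂ) := by
    intro t
    have : (S χ t).im = 0 := by
      unfold S
      rw [Complex.im_sum]
      refine Finset.sum_eq_zero fun n _ => ?_
      rcases MulChar.isQuadratic_iff_sq_eq_one.mpr h2 n with h | h | h <;> simp [h]
    apply Complex.ext <;> simp [this]
  have : LFunction χ x = ((x * ∫ t in Ioi (1:ℝ), (S χ t).re * t ^ (-(x+1)) : ℝ) : ℂ) := by
    rw [L_repr hχ (by simpa using hx)]
    push_cast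
    congr 1
    rw [← integral_complex_ofReal]
    refine setIntegral_congr_fun measurableSet_Ioi fun t ht => ?_
    have ht0 : (0:ℝ) ≤ t := by have : (1:ℝ) < t := ht; linarith
    rw [hS t]
    push_cast
    rw [Complex.ofReal_cpow ht0]
    simp
  rw [this]; simp

lemma L_pos {N : ℕ} [NeZero N] {χ : DirichletCharacter ℂ N} (hχ : χ ≠ 1) (h2 : χ^2 = 1) {b : ℝ}
    (hb : 0 < b) (hb1 : b ≤ 2) (hz : ∀ x : ℝ, b ≤ x → LFunction χ x ≠ 0) : 0 < (LFunction χ b).re := by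
  have hL2 : 0 < (LFunction χ (2:ℝ)).re := by
    have h1 := zetaL χ (s := (2:ℝ)) (by simp)
    have habs : LSeries.abscissaOfAbsConv χ.zetaMul < (2:ℝ) := by
      refine lt_of_le_of_lt (LSeries.abscissaOfAbsConv_le_of_forall_lt_LSeriesSummable (x := 1)
        fun _ a ↦ χ.LSeriesSummable_zetaMul a) ?_
      exact_mod_cast (by norm_num : (1:ℝ) < 2)
    have h3 := LSeries.positive (zetaMul_nonneg h2) (χ.isMultiplicative_zetaMul.map_one ▸ zero_lt_one) habs
    rw [← h1, L_real hχ h2 (by norm_num), show ((2:ℝ):ℂ) = 2 by norm_num, riemannZeta_two] at h3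
    have h4 := (Complex.lt_def.1 h3).1
    have h5 : ((Real.pi:ℂ)^2/6 * ((LFunction χ 2).re:ℂ)).re = Real.pi^2/6 * (LFunction χ 2).re := by
      rw [show (Real.pi:ℂ)^2/6 * ((LFunction χ 2).re:ℂ) = ((Real.pi^2/6 * (LFunction χ 2).re : ℝ):ℂ) by push_cast; ring]
      rw [Complex.ofReal_re]
    rw [h5] at h4
    simp only [Complex.zero_re] at h4
    have hp : 0 < Real.pi^2/6 := by positivity
    rw [show ((2:ℝ):ℂ) = 2 by norm_num]
    exact pos_of_mul_pos_right h4 hp.le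
  by_contra hneg
  push Not at hneg
  have hc : ContinuousOn (fun x : ℝ => (LFunction χ x).re) (Icc b 2) := by
    apply Continuous.continuousOn
    exact Complex.continuous_re.comp ((differentiable_LFunction hχ).continuous.comp Complex.continuous_ofReal)
  obtain ⟨x, hx, hx0⟩ := intermediate_value_Icc hb1 hc ⟨hneg, hL2.le⟩
  refine hz x hx.1 ?_
  rw [L_real hχ h2 (lt_of_lt_of_le hb hx.1)]
  simpa using hx0

end NSM

namespace NSM
open scoped ComplexOrder
open MeasureTheory Set Filter Topology

noncomputable def G {N : ℕ} [NeZero N] (χ : DirichletCharacter ℂ N) : ℂ → ℂ :=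
  dslope (fun s => Z s * LFunction χ s) 1

lemma G_ne {N : ℕ} [NeZero N] (χ : DirichletCharacter ℂ N) {s : ℂ} (hs : s ≠ 1) :
    G χ s = (Z s * LFunction χ s - LFunction χ 1) / (s - 1) := by
  unfold G
  rw [dslope_of_ne _ hs, slope_def_field, Z_one, one_mul]

lemma G_diff {N : ℕ} [NeZero N] {χ : DirichletCharacter ℂ N} (hχ : χ ≠ 1) : Differentiable ℂ (G χ) := by
  rw [← differentiableOn_univ]
  unfold G
  rw [Complex.differentiableOn_dslope univ_mem, differentiableOn_univ]
  exact Z_diff.mul (differentiable_LFunction hχ)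

lemma habs {N : ℕ} (χ : DirichletCharacter ℂ N) : LSeries.abscissaOfAbsConv χ.zetaMul < (2:ℝ) := by
  refine lt_of_le_of_lt (LSeries.abscissaOfAbsConv_le_of_forall_lt_LSeriesSummable (x := 1)
    fun _ a ↦ χ.LSeriesSummable_zetaMul a) ?_
  exact_mod_cast (by norm_num : (1:ℝ) < 2)

lemma G_iter {N : ℕ} [NeZero N] (χ : DirichletCharacter ℂ N) (m : ℕ) :
    iteratedDeriv m (G χ) 2 = iteratedDeriv m (LSeries χ.zetaMul) (2:ℝ) -
      LFunction χ 1 * ((-1)^m * m.factorial) := by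
  have h1 : G χ =ᶠ[𝓝 2] fun s => LSeries χ.zetaMul s - LFunction χ 1 * (s - 1)⁻¹ := by
    have : {s : ℂ | 1 < s.re} ∈ 𝓝 (2:ℂ) :=
      (isOpen_lt continuous_const Complex.continuous_re).mem_nhds (by simp)
    filter_upwards [this] with s hs
    have hs1 : s ≠ 1 := by rintro rfl; simp at hs
    have hs2 : s - 1 ≠ 0 := sub_ne_zero.2 hs1
    rw [G_ne χ hs1, ← zetaL χ hs, Z_ne hs1]
    field_simp
  rw [h1.iteratedDeriv_eq]
  have hL : AnalyticAt ℂ (LSeries χ.zetaMul) 2 := by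
    apply LSeries_analyticOnNhd
    have := habs χ
    simpa using this
  have hI : AnalyticAt ℂ (fun s : ℂ => LFunction χ 1 * (s - 1)⁻¹) 2 := by
    refine analyticAt_const.mul ((analyticAt_id.sub analyticAt_const).inv ?_)
    norm_num
  rw [iteratedDeriv_fun_sub hL.contDiffAt hI.contDiffAt, iteratedDeriv_const_mul_field,
    iteratedDeriv_comp_sub_const m (fun z : ℂ => z⁻¹) 1]
  have := iter_deriv_inv (𝕜 := ℂ) m (2 - 1)
  have h3 : iteratedDeriv m (fun z : ℂ => z⁻¹) (2 - 1) = (-1)^m * m.factorial := by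
    rw [iteratedDeriv_eq_iterate, show (fun z : ℂ => z⁻¹) = Inv.inv from rfl, this]; norm_num
  simp only [h3]
  rfl

lemma LS_ge_one {N : ℕ} {χ : DirichletCharacter ℂ N} (h2 : χ^2 = 1) :
    1 ≤ (LSeries χ.zetaMul (2:ℝ)).re := by
  have hsm : LSeriesSummable χ.zetaMul (2:ℝ) :=
    LSeriesSummable_of_abscissaOfAbsConv_lt_re (by simpa using habs χ)
  have h := hsm.le_tsum 1 (fun n _ => LSeries.term_nonneg (zetaMul_nonneg h2 n) 2)
  have h1 : LSeries.term χ.zetaMul (2:ℝ) 1 = 1 := by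
    rw [LSeries.term_of_ne_zero one_ne_zero, χ.isMultiplicative_zetaMul.map_one]; simp
  rw [h1] at h
  exact (Complex.le_def.1 h).1

/-- Landau-type lower bound in abstract form. -/
lemma core : ∃ C ≥ (1:ℝ), ∀ (N : ℕ) [NeZero N] (χ : DirichletCharacter ℂ N), χ ≠ 1 → χ^2 = 1 →
    ∀ (η : ℝ), 0 < η → η ≤ 1/10 → 0 ≤ (Z ((1 - η : ℝ))).re →
    (∀ x : ℝ, 1 - η ≤ x → LFunction χ x ≠ 0) → ∀ M : ℕ, 1 ≤ M → 4 * (C * N) * (3/4)^M ≤ (1/2:ℝ) →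
    1/2 ≤ (LFunction χ 1).re * (1 + η)^M / η := by
  obtain ⟨B, hB⟩ := (isCompact_sphere (2:ℂ) (3/2)).exists_bound_of_continuousOn Z_diff.continuous.continuousOn
  have hB0 : 0 ≤ B := by
    refine (norm_nonneg _).trans (hB (7/2) ?_)
    simp only [mem_sphere_iff_norm]; norm_num
  refine ⟨14 * B + 2, by linarith, ?_⟩
  intro N _ χ hχ h2 η hη hη1 hZ hz M hM htail
  set K := (14 * B + 2) * N with hK
  have hGK : ∀ s ∈ Metric.sphere (2:ℂ) (3/2), ‖G χ s‖ ≤ K := by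
    intro s hs
    have hs' := hs
    rw [mem_sphere_iff_norm] at hs'
    have hre : 1/2 ≤ s.re := by
      have := (abs_le.1 (Complex.abs_re_le_norm (s - 2))).1
      simp at this; linarith
    have hsn : ‖s‖ ≤ 7/2 := by
      calc ‖s‖ = ‖(s - 2) + 2‖ := by ring_nf
        _ ≤ ‖s - 2‖ + ‖(2:ℂ)‖ := norm_add_le _ _
        _ = 7/2 := by rw [hs']; norm_num
    have hs1 : 1/2 ≤ ‖s - 1‖ := by
      have := norm_sub_norm_le (s - 2) (-1)
      rw [hs'] at this
      rw [show s - 2 - -1 = s - 1 by ring] at this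
      norm_num at this ⊢; linarith
    have hne : s ≠ 1 := by rintro rfl; norm_num at hs1
    have hN1 : (1:ℝ) ≤ N := by exact_mod_cast NeZero.one_le
    have hL : ‖LFunction χ s‖ ≤ 7 * N := by
      have := norm_L_le hχ (s := s) (θ := 1) (by norm_num) le_rfl (by linarith)
      refine this.trans ?_
      rw [Real.rpow_one]
      calc ‖s‖ * ((N:ℝ) / (s.re - (1-1))) ≤ (7/2) * (N / (1/2)) := by
            have h0 : 1/2 ≤ s.re - (1-1) := by linarith
            have h00 : 0 < s.re - (1-1) := by linarith
            gcongr
        _ = _ := by ring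
    have hL1 : ‖LFunction χ 1‖ ≤ N := by
      have := norm_L_le hχ (s := 1) (θ := 1) (by norm_num) le_rfl (by norm_num)
      simpa using this
    rw [G_ne χ hne, norm_div, div_le_iff₀ (by linarith)]
    calc ‖Z s * LFunction χ s - LFunction χ 1‖ ≤ ‖Z s * LFunction χ s‖ + ‖LFunction χ 1‖ := norm_sub_le _ _
      _ ≤ B * (7 * N) + N := by
          rw [norm_mul]
          have := hB s hs
          gcongr
      _ = K * (1/2) := by rw [hK]; ring
      _ ≤ K * ‖s - 1‖ := by gcongr
  set e : ℕ → ℝ := fun m => ((-1)^m * ((m.factorial:ℂ))⁻¹ * iteratedDeriv m (G χ) 2).re with he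
  have hcoef : ∀ m, e m = ((-1)^m * iteratedDeriv m (LSeries χ.zetaMul) (2:ℝ)).re / m.factorial
      - (LFunction χ 1).re := by
    intro m
    have hf : (m.factorial : ℂ) ≠ 0 := by exact_mod_cast m.factorial_ne_zero
    simp only [he]
    rw [G_iter]
    have h1 : (-1:ℂ)^m * (-1)^m = 1 := by rw [← mul_pow]; norm_num
    have : (-1)^m * ((m.factorial:ℂ))⁻¹ * (iteratedDeriv m (LSeries χ.zetaMul) (2:ℝ) -
      LFunction χ 1 * ((-1)^m * m.factorial)) = ((-1)^m * iteratedDeriv m (LSeries χ.zetaMul) (2:ℝ)) / (m.factorial : ℂ)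
      - LFunction χ 1 := by
      field_simp
      linear_combination (- LFunction χ 1 * m.factorial) * h1
    rw [this, Complex.sub_re, Complex.div_natCast_re]
  refine taylor_ineq (e := e) (g := (G χ ((1 - η : ℝ))).re) (K := K) hη hη1 hM ?_ ?_ ?_ ?_ ?_ htail
  · have h := Complex.hasSum_re (Complex.hasSum_taylorSeries_of_entire (G_diff hχ) 2 ((1 - η : ℝ)))
    refine h.congr_fun ?_ |> fun h => h
    intro m
    have : ((m.factorial:ℂ))⁻¹ • ((((1 - η : ℝ)):ℂ) - 2)^m • iteratedDeriv m (G χ) 2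
        = (((1+η)^m : ℝ):ℂ) * ((-1)^m * ((m.factorial:ℂ))⁻¹ * iteratedDeriv m (G χ) 2) := by
      have : ((((1 - η : ℝ)):ℂ) - 2) = -1 * (1 + η) := by push_cast; ring
      rw [this, mul_pow]
      push_cast
      simp only [smul_eq_mul]
      ring
    rw [this, Complex.re_ofReal_mul]
  · rw [hcoef 0]
    have := LS_ge_one h2
    simp only [pow_zero, iteratedDeriv_zero, one_mul, Nat.factorial_zero, Nat.cast_one, div_one]
    linarith
  · intro m
    rw [hcoef m]
    have h := LSeries.iteratedDeriv_alternating (zetaMul_nonneg h2) (habs χ) m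
    have h' := (Complex.le_def.1 h).1
    have : 0 ≤ ((-1)^m * iteratedDeriv m (LSeries χ.zetaMul) (2:ℝ)).re / m.factorial :=
      div_nonneg (by simpa using h') (by positivity)
    linarith
  · intro m
    have h := Complex.norm_iteratedDeriv_le_of_forall_mem_sphere_norm_le m (by norm_num)
      (G_diff hχ).diffContOnCl hGK
    refine (Complex.abs_re_le_norm _).trans ?_
    rw [norm_mul, norm_mul]
    have hf : (0:ℝ) < m.factorial := by exact_mod_cast m.factorial_pos
    simp only [norm_pow, norm_neg, norm_one, one_pow, one_mul, norm_inv, Complex.norm_natCast]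
    calc ((m.factorial:ℝ))⁻¹ * ‖iteratedDeriv m (G χ) 2‖ ≤ ((m.factorial:ℝ))⁻¹ * (m.factorial * K / (3/2)^m) := by gcongr
      _ = K / (3/2)^m := by field_simp
      _ = K * (2/3)^m := by rw [div_eq_mul_inv, ← inv_pow]; norm_num
  · have hne : (((1 - η : ℝ)):ℂ) ≠ 1 := by
      norm_cast; linarith
    rw [G_ne χ hne]
    have h1 : ((((1 - η : ℝ)):ℂ) - 1) = ((-η : ℝ) : ℂ) := by push_cast; ring
    rw [h1, Complex.div_ofReal_re, Complex.sub_re, L_real hχ h2 (by linarith : 0 < 1 - η), Complex.re_mul_ofReal]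
    have hp := L_pos hχ h2 (by linarith : 0 < 1 - η) (by linarith) hz
    have : 0 ≤ (Z ((1 - η : ℝ))).re * (LFunction χ ((1 - η : ℝ))).re := mul_nonneg hZ hp.le
    rw [div_neg, ← neg_div]
    gcongr
    linarith

lemma RC : ∃ c0 > (0:ℝ), ∃ c > (0:ℝ), ∀ (N : ℕ) [NeZero N] (χ : DirichletCharacter ℂ N), 2 ≤ N →
    χ ≠ 1 → χ^2 = 1 → (∀ β : ℝ, 1 - c0 / Real.log N ≤ β → LFunction χ β ≠ 0) →
    c / Real.log N ≤ ‖LFunction χ 1‖ := by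
  obtain ⟨C, hC1, hC⟩ := core
  obtain ⟨ε, hε, hεZ⟩ : ∃ ε > 0, ∀ s : ℂ, ‖s - 1‖ < ε → 0 ≤ (Z s).re := by
    have hc : ContinuousAt (fun s => (Z s).re) 1 := (Complex.continuous_re.comp Z_diff.continuous).continuousAt
    have := hc.eventually (lt_mem_nhds (show 0 < (Z 1).re by rw [Z_one]; simp))
    obtain ⟨ε, hε, h⟩ := Metric.eventually_nhds_iff.1 this
    exact ⟨ε, hε, fun s hs => (h (by rwa [dist_eq_norm])).le⟩
  set ε' := min ε (1/10) with hε'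
  have hε'0 : 0 < ε' := lt_min hε (by norm_num)
  have hl2 := Real.log_two_gt_d9
  set A : ℝ := 2 * (4 * Real.log (8 * C) + 2) + 4 with hA
  have hlC : 0 ≤ Real.log (8 * C) := Real.log_nonneg (by linarith)
  refine ⟨ε'/2, by positivity, ε'/4 * Real.exp (-(ε'/2 * A)), by positivity, ?_⟩
  intro N _ χ hN hχ h2 hz
  have hN' : (2:ℝ) ≤ N := by exact_mod_cast hN
  have hlN : Real.log 2 ≤ Real.log N := Real.log_le_log (by norm_num) hN'
  have hlN0 : 0 < Real.log N := by linarith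
  set η := ε'/2 / Real.log N with hη
  have hη0 : 0 < η := by positivity
  have hη1 : η < ε' := by
    rw [hη, div_lt_iff₀ hlN0]; nlinarith
  set M := ⌈4 * (Real.log (8 * C) + Real.log N)⌉₊ + 1 with hM
  have hM1 : 4 * (Real.log (8 * C) + Real.log N) ≤ M := by
    rw [hM]; push_cast
    linarith [Nat.le_ceil (4 * (Real.log (8 * C) + Real.log N))]
  have hM2 : (M:ℝ) ≤ A * Real.log N := by
    have h1 : (M:ℝ) ≤ 4 * (Real.log (8 * C) + Real.log N) + 2 := by
      rw [hM]; push_cast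
      linarith [Nat.ceil_lt_add_one (show 0 ≤ 4 * (Real.log (8 * C) + Real.log N) by positivity)]
    rw [hA]
    nlinarith
  have hCN : 0 < 8 * C * N := by positivity
  have key := hC N χ hχ h2 η hη0 (hη1.le.trans (min_le_right _ _)) (hεZ _ (by
      rw [show (((1-η:ℝ)):ℂ) - 1 = ((-η:ℝ):ℂ) by push_cast; ring, Complex.norm_real, Real.norm_eq_abs, abs_neg,
        abs_of_pos hη0]
      exact hη1.trans_le (min_le_left _ _))) hz M (by omega) (by
    have h1 : ((3/4:ℝ))^M ≤ (8 * C * N)⁻¹ := by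
      calc ((3/4:ℝ))^M ≤ (Real.exp (-(1/4)))^M := by
            gcongr
            have := Real.add_one_le_exp (-(1/4):ℝ)
            linarith
        _ = Real.exp (-(M/4)) := by rw [← Real.exp_nat_mul]; ring_nf
        _ ≤ Real.exp (-(Real.log (8 * C) + Real.log N)) := by
            apply Real.exp_le_exp.2; linarith
        _ = (8 * C * N)⁻¹ := by
            rw [← Real.log_mul (by positivity) (by positivity), Real.exp_neg, Real.exp_log hCN]
    calc 4 * (C * N) * (3/4:ℝ)^M ≤ 4 * (C * N) * (8 * C * N)⁻¹ := by gcongr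
      _ = 1/2 := by field_simp; norm_num)
  have hp : (1 + η)^M ≤ Real.exp (ε'/2 * A) := by
    calc (1+η)^M ≤ (Real.exp η)^M := by
          gcongr
          linarith [Real.add_one_le_exp η]
      _ = Real.exp (M * η) := by rw [← Real.exp_nat_mul]
      _ ≤ _ := by
          apply Real.exp_le_exp.2
          calc (M:ℝ) * η ≤ A * Real.log N * η := by gcongr
            _ = ε'/2 * A := by rw [hη]; field_simp
  have hre : (LFunction χ 1).re ≤ ‖LFunction χ 1‖ := Complex.re_le_norm _
  have h3 : 1/2 * η ≤ ‖LFunction χ 1‖ * Real.exp (ε'/2 * A) := by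
    rw [le_div_iff₀ hη0] at key
    refine key.trans ?_
    gcongr
  have h4 : Real.exp (-(ε'/2 * A)) * Real.exp (ε'/2 * A) = 1 := by rw [← Real.exp_add]; simp
  have h5 : ε'/4 * Real.exp (-(ε'/2 * A)) / Real.log N = (1/2 * η) * Real.exp (-(ε'/2*A)) := by rw [hη]; ring
  rw [h5]
  calc (1/2 * η) * Real.exp (-(ε'/2*A)) ≤ (‖LFunction χ 1‖ * Real.exp (ε'/2 * A)) * Real.exp (-(ε'/2*A)) := by gcongr
    _ = ‖LFunction χ 1‖ := by rw [mul_assoc, mul_comm (Real.exp _), h4, mul_one]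

end NSM

namespace NSM
open MeasureTheory Set Filter Topology

noncomputable def ww (δ : ℝ) (n : ℕ) : ℝ := (ArithmeticFunction.moebius n : ℝ) * (n:ℝ)^(-1-δ)

lemma mu_abs (n : ℕ) : |(ArithmeticFunction.moebius n : ℝ)| ≤ 1 := by
  exact_mod_cast ArithmeticFunction.abs_moebius_le_one (n := n)

lemma ww_le (δ : ℝ) (n : ℕ) : |ww δ n| ≤ (n:ℝ)^(-1-δ) := by
  unfold ww
  rw [abs_mul, abs_of_nonneg (by positivity : (0:ℝ) ≤ (n:ℝ)^(-1-δ))]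
  exact mul_le_of_le_one_left (by positivity) (mu_abs n)

lemma ww_summable {δ : ℝ} (hδ : 0 < δ) : Summable (ww δ) :=
  Summable.of_norm_bounded (zsummable0 hδ) (fun n => by simpa using ww_le δ n)

lemma ww_abs_summable {δ : ℝ} (hδ : 0 < δ) : Summable (fun n => |ww δ n|) :=
  Summable.of_nonneg_of_le (fun _ => abs_nonneg _) (fun n => ww_le δ n) (zsummable0 hδ)

noncomputable def gg (N : ℕ) (δ : ℝ) (a : ZMod N) : ℝ :=
  ∑' n : ℕ, if (n : ZMod N) = a then ww δ n else 0

lemma gg_summable (N : ℕ) {δ : ℝ} (hδ : 0 < δ) (a : ZMod N) :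
    Summable fun n : ℕ => if (n : ZMod N) = a then ww δ n else 0 := by
  refine Summable.of_norm_bounded (ww_abs_summable hδ) (fun n => ?_)
  split_ifs <;> simp

lemma L_inv {N : ℕ} [NeZero N] (χ : DirichletCharacter ℂ N) {δ : ℝ} (hδ : 0 < δ) :
    (LFunction χ (1 + δ))⁻¹ = ∑' n : ℕ, χ n * (ww δ n : ℂ) := by
  have hs : 1 < (1 + δ : ℂ).re := by simpa using hδ
  have h := LSeries.mul_mu_eq_one χ hs
  rw [χ.LFunction_eq_LSeries hs, inv_eq_of_mul_eq_one_right h]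
  unfold LSeries
  refine tsum_congr fun n => ?_
  rcases eq_or_ne n 0 with rfl | hn
  · simp [ww]
  rw [LSeries.term_of_ne_zero hn]
  simp only [Pi.mul_apply, ww]
  push_cast
  rw [Complex.ofReal_cpow (by positivity), div_eq_mul_inv, ← Complex.cpow_neg, mul_assoc]
  push_cast
  ring_nf

lemma L_inv_units {N : ℕ} [NeZero N] (χ : DirichletCharacter ℂ N) {δ : ℝ} (hδ : 0 < δ) :
    (LFunction χ (1 + δ))⁻¹ = ∑ u : (ZMod N)ˣ, χ u * (gg N δ u : ℂ) := by
  rw [L_inv χ hδ]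
  have h1 : ∀ u : (ZMod N)ˣ, χ u * (gg N δ u : ℂ) =
      ∑' n : ℕ, χ u * ((if (n : ZMod N) = u then ww δ n else 0 : ℝ):ℂ) := by
    intro u
    unfold gg
    rw [Complex.ofReal_tsum, tsum_mul_left]
  simp_rw [h1]
  rw [← Summable.tsum_finsetSum]
  · refine tsum_congr fun n => ?_
    by_cases hn : IsUnit (n : ZMod N)
    · obtain ⟨v, hv⟩ := hn
      rw [← hv]
      rw [Finset.sum_eq_single v]
      · simp
      · intro b _ hb
        rw [if_neg (fun h => hb (Units.ext h.symm))]; simp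
      · simp
    · rw [MulChar.map_nonunit χ hn, zero_mul]
      symm
      refine Finset.sum_eq_zero fun u _ => ?_
      rw [if_neg]; · simp
      rintro h; rw [h] at hn; exact hn u.isUnit
  · intro u _
    have := (gg_summable N hδ (u:ZMod N))
    have h2 : Summable fun n : ℕ => ((if (n : ZMod N) = u then ww δ n else 0 : ℝ):ℂ) := by
      exact Complex.ofRealCLM.summable this
    exact h2.mul_left _

lemma parseval {N : ℕ} [NeZero N] (g : (ZMod N)ˣ → ℂ) :
    ∑ χ : DirichletCharacter ℂ N, ‖∑ u : (ZMod N)ˣ, χ u * g u‖^2 = N.totient * ∑ u, ‖g u‖^2 := by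
  have key : ((∑ χ : DirichletCharacter ℂ N, ‖∑ u : (ZMod N)ˣ, χ u * g u‖^2 : ℝ) : ℂ) =
      ((N.totient * ∑ u, ‖g u‖^2 : ℝ) : ℂ) := by
    push_cast
    have h1 : ∀ χ : DirichletCharacter ℂ N, ((‖∑ u : (ZMod N)ˣ, χ u * g u‖:ℂ))^2 =
        ∑ u : (ZMod N)ˣ, ∑ v : (ZMod N)ˣ, (χ (v:ZMod N)⁻¹ * χ u) * (g u * starRingEnd ℂ (g v)) := by
      intro χ
      rw [← Complex.mul_conj', map_sum, Finset.sum_mul_sum]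
      refine Finset.sum_congr rfl fun u _ => Finset.sum_congr rfl fun v _ => ?_
      rw [map_mul]
      have : starRingEnd ℂ (χ v) = χ (v:ZMod N)⁻¹ := by
        rw [starRingEnd_apply, MulChar.star_apply', MulChar.inv_apply, ZMod.inv_coe_unit,
          Ring.inverse_unit]
      rw [this]; ring
    simp_rw [h1]
    rw [Finset.sum_comm, Finset.mul_sum]
    refine Finset.sum_congr rfl fun u _ => ?_
    rw [Finset.sum_comm, Finset.sum_eq_single u]
    · rw [← Finset.sum_mul, sum_char_inv_mul_char_eq ℂ u.isUnit, if_pos rfl, Complex.mul_conj']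
    · intro v _ hv
      rw [← Finset.sum_mul, sum_char_inv_mul_char_eq ℂ v.isUnit, if_neg (fun h => hv (Units.ext h)), zero_mul]
    · simp
  exact_mod_cast key

noncomputable def GG (N : ℕ) (δ : ℝ) (u : (ZMod N)ˣ) : ℝ := (gg N δ u + gg N δ (-u : (ZMod N)ˣ)) / 2

lemma even_sum {N : ℕ} [NeZero N] {δ : ℝ} (hδ : 0 < δ) [DecidablePred fun χ : DirichletCharacter ℂ N => χ.Even] :
    ∑ χ : DirichletCharacter ℂ N, (if χ.Even then 1 / ‖LFunction χ (1 + δ)‖^2 else 0) =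
      N.totient * ∑ u, (GG N δ u)^2 := by
  have := parseval (fun u => (GG N δ u : ℂ))
  simp only [Complex.norm_real, Real.norm_eq_abs, sq_abs] at this
  rw [← this]
  refine Finset.sum_congr rfl fun χ _ => ?_
  have h1 : ∑ u : (ZMod N)ˣ, χ u * (GG N δ u : ℂ) = (1 + χ (-1)) / 2 * (LFunction χ (1 + δ))⁻¹ := by
    have h2 : ∑ u : (ZMod N)ˣ, χ u * (gg N δ (-u : (ZMod N)ˣ) : ℂ) = χ (-1) * (LFunction χ (1 + δ))⁻¹ := by
      rw [L_inv_units χ hδ, ← Equiv.sum_comp (Equiv.neg (ZMod N)ˣ), Finset.mul_sum]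
      refine Finset.sum_congr rfl fun u _ => ?_
      simp only [Equiv.neg_apply, neg_neg]
      rw [Units.val_neg, ← neg_one_mul, map_mul]; ring
    have h3 := L_inv_units χ hδ
    have : ∀ u : (ZMod N)ˣ, χ u * (GG N δ u : ℂ) = (χ u * (gg N δ u : ℂ) + χ u * (gg N δ (-u : (ZMod N)ˣ) : ℂ)) / 2 := by
      intro u; unfold GG; push_cast; ring
    simp_rw [this]
    rw [← Finset.sum_div, Finset.sum_add_distrib, h2, ← h3]; ring
  rw [h1]
  rcases χ.even_or_odd with h | h
  · rw [if_pos h, show χ (-1) = 1 from h]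
    simp
  · have h' : ¬ χ.Even := fun h' => by
      have : (1:ℂ) = -1 := h'.symm.trans h
      norm_num at this
    rw [if_neg h', show χ (-1) = -1 from h]
    simp

lemma gg_approx {N : ℕ} [NeZero N] {δ : ℝ} (hδ : 0 < δ) (a : ZMod N) :
    |gg N δ a - ww δ a.val| ≤ (1 + 1/δ) / N := by
  have hN : 0 < N := NeZero.pos N
  have hinj : Function.Injective (fun m : ℕ => a.val + N * m) := by
    intro m m' h
    simpa [hN.ne'] using h
  have h1 : gg N δ a = ∑' m : ℕ, ww δ (a.val + N * m) := by
    unfold gg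
    rw [← hinj.tsum_eq]
    · refine tsum_congr fun m => ?_
      rw [if_pos]; simp
    · intro n hn
      have : (n : ZMod N) = a := by
        by_contra h; simp [h] at hn
      refine ⟨n / N, ?_⟩
      simp only
      rw [← this, ZMod.val_natCast, Nat.mod_add_div]
  have hs : Summable fun m : ℕ => ww δ (a.val + N * m) := (ww_summable hδ).comp_injective hinj
  rw [h1, hs.tsum_eq_zero_add]
  simp only [mul_zero, add_zero, add_sub_cancel_left]
  have h2 : HasSum (fun m : ℕ => ((m:ℝ)+1)^(-1-δ) / N) ((∑' m : ℕ, ((m:ℝ)+1)^(-1-δ)) / N) :=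
    (zsummable hδ).hasSum.div_const _
  have hN1 : (1:ℝ) ≤ N := by exact_mod_cast hN
  refine (tsum_of_norm_bounded (f := fun m : ℕ => ww δ (a.val + N * (m+1))) h2 (fun m => ?_)).trans ?_
  · refine (ww_le δ _).trans ?_
    have : ((N:ℝ) * ((m:ℝ)+1)) ≤ ((a.val + N * (m+1) : ℕ) : ℝ) := by push_cast; linarith [Nat.cast_nonneg (α := ℝ) a.val]
    calc _ ≤ ((N:ℝ) * ((m:ℝ)+1))^(-1-δ) := by
          exact Real.rpow_le_rpow_of_nonpos (by positivity) this (by linarith)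
      _ = (N:ℝ)^(-1-δ) * ((m:ℝ)+1)^(-1-δ) := Real.mul_rpow (by positivity) (by positivity)
      _ ≤ (N:ℝ)^(-1:ℝ) * ((m:ℝ)+1)^(-1-δ) := by
          gcongr
          linarith
      _ = _ := by rw [Real.rpow_neg_one]; ring
  · gcongr; exact ztsum hδ

end NSM

namespace NSM
open MeasureTheory Set Filter Topology

lemma quad {U : Type*} [Fintype U] (m G : U → ℝ) (σ : U ≃ U) {η b W : ℝ}
    (hb : 0 ≤ b) (hη : 0 ≤ η) (hG : ∀ u, |G u - (m u + m (σ u))/2| ≤ η)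
    (hm : ∀ u, |m u * m (σ u)| ≤ b * (|m u| + |m (σ u)|)) (hW : ∑ u, |m u| ≤ W) :
    |∑ u, (G u)^2 - 1/2 * ∑ u, (m u)^2| ≤ (2 * η + b) * W + Fintype.card U * η^2 := by
  have h1 : ∑ u, (G u)^2 - 1/2 * ∑ u, (m u)^2 = ∑ u, ((G u)^2 - ((m u)^2 + (m (σ u))^2)/4) := by
    rw [Finset.sum_sub_distrib, ← Finset.sum_div, Finset.sum_add_distrib,
      Equiv.sum_comp σ (fun u => (m u)^2)]
    ring
  rw [h1]
  have h2 : ∀ u, |(G u)^2 - ((m u)^2 + (m (σ u))^2)/4| ≤ (η + b/2) * (|m u| + |m (σ u)|) + η^2 := by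
    intro u
    set A := (m u + m (σ u))/2 with hA
    set H := G u - A with hH
    have hGu : G u = A + H := by rw [hH]; ring
    have e : (G u)^2 - ((m u)^2 + (m (σ u))^2)/4 = H * (m u) + H * (m (σ u)) + H^2 + (m u * m (σ u))/2 := by
      rw [hGu, hA]; ring
    rw [e]
    have hHη : |H| ≤ η := hG u
    have a1 : |H * m u| ≤ η * |m u| := by rw [abs_mul]; gcongr
    have a2 : |H * m (σ u)| ≤ η * |m (σ u)| := by rw [abs_mul]; gcongr
    have a3 : |H^2| ≤ η^2 := by rw [abs_pow]; gcongr
    have a4 : |m u * m (σ u) / 2| ≤ b * (|m u| + |m (σ u)|) / 2 := by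
      rw [abs_div, abs_two]; gcongr; exact hm u
    calc _ ≤ |H * m u| + |H * m (σ u)| + |H^2| + |m u * m (σ u) / 2| := by
          refine (abs_add_le _ _).trans (add_le_add_left ((abs_add_le _ _).trans (add_le_add_left (abs_add_le _ _) _)) _)
      _ ≤ _ := by linarith
  refine (Finset.abs_sum_le_sum_abs _ _).trans ((Finset.sum_le_sum fun u _ => h2 u).trans ?_)
  rw [Finset.sum_add_distrib, ← Finset.mul_sum, Finset.sum_add_distrib,
    Equiv.sum_comp σ (fun u => |m u|)]
  simp only [Finset.sum_const, Finset.card_univ, nsmul_eq_mul]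
  have : (η + b/2) * (∑ u, |m u| + ∑ u, |m u|) ≤ (η + b/2) * (W + W) := by gcongr
  linarith

lemma units_sum {N : ℕ} [NeZero N] (F : ℕ → ℝ) :
    ∑ u : (ZMod N)ˣ, F (u : ZMod N).val = ∑ n ∈ (Finset.range N).filter (fun n => n.Coprime N), F n := by
  refine Finset.sum_bij (fun u _ => (u : ZMod N).val) ?_ ?_ ?_ ?_
  · intro u _
    simp only [Finset.mem_filter, Finset.mem_range]
    exact ⟨ZMod.val_lt _, ZMod.val_coe_unit_coprime u⟩
  · intro u _ v _ h
    exact Units.ext (ZMod.val_injective N h)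
  · intro n hn
    simp only [Finset.mem_filter, Finset.mem_range] at hn
    refine ⟨ZMod.unitOfCoprime n hn.2, Finset.mem_univ _, ?_⟩
    simp [ZMod.val_natCast_of_lt hn.1]
  · intros; rfl

noncomputable def AN (N : ℕ) : ℝ :=
  ∑' n : ℕ, if n.Coprime N then (ArithmeticFunction.moebius n : ℝ)^2 / (n:ℝ)^2 else 0

lemma mu_sq_le (n : ℕ) : (ArithmeticFunction.moebius n : ℝ)^2 ≤ 1 := by
  rw [← sq_abs]; exact pow_le_one₀ (abs_nonneg _) (mu_abs n)

lemma AN_summable (N : ℕ) : Summable fun n : ℕ =>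
    if n.Coprime N then (ArithmeticFunction.moebius n : ℝ)^2 / (n:ℝ)^2 else 0 := by
  refine Summable.of_nonneg_of_le (fun n => ?_) (fun n => ?_) (zsummable0 (x := 1) one_pos)
  · split_ifs <;> positivity
  · have : (n:ℝ)^(-1-1:ℝ) = 1/(n:ℝ)^2 := by
      rw [show (-1-1:ℝ) = -(2:ℕ) by norm_num, Real.rpow_neg (by positivity), Real.rpow_natCast]; simp
    rw [this]
    split_ifs
    · gcongr; exact mu_sq_le n
    · positivity

lemma AN_le (N : ℕ) : 0 ≤ AN N ∧ AN N ≤ 2 := by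
  constructor
  · exact tsum_nonneg fun n => by split_ifs <;> positivity
  · refine ((AN_summable N).tsum_le_tsum (fun n => ?_) (zsummable0 (x := 1) one_pos)).trans
      ((ztsum0 one_pos).trans (by norm_num))
    have : (n:ℝ)^(-1-1:ℝ) = 1/(n:ℝ)^2 := by
      rw [show (-1-1:ℝ) = -(2:ℕ) by norm_num, Real.rpow_neg (by positivity), Real.rpow_natCast]; simp
    rw [this]
    split_ifs
    · gcongr; exact mu_sq_le n
    · positivity

lemma diag {N : ℕ} [NeZero N] {δ : ℝ} (hδ : 0 < δ) :
    |∑ u : (ZMod N)ˣ, (ww δ (u : ZMod N).val)^2 - AN N| ≤ 3 * (4 * δ + (N:ℝ)^(-(1/2):ℝ)) := by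
  rw [units_sum (fun n => (ww δ n)^2)]
  have h1 : HasSum (fun n => if n ∈ (Finset.range N).filter (fun n => n.Coprime N) then (ww δ n)^2 else 0)
      (∑ n ∈ (Finset.range N).filter (fun n => n.Coprime N), (ww δ n)^2) := by
    have := hasSum_sum_of_ne_finset_zero (L := SummationFilter.unconditional ℕ) (f := fun n => if n ∈ (Finset.range N).filter (fun n => n.Coprime N) then (ww δ n)^2 else 0)
      (s := (Finset.range N).filter (fun n => n.Coprime N)) (fun b hb => if_neg hb)
    rwa [Finset.sum_congr rfl (fun n hn => if_pos hn)] at this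
  have h2 := h1.sub (AN_summable N).hasSum
  have h3 : HasSum (fun n : ℕ => (n:ℝ)^(-1-(1/2):ℝ) * (4 * δ + (N:ℝ)^(-(1/2):ℝ)))
      ((∑' n : ℕ, (n:ℝ)^(-1-(1/2):ℝ)) * (4 * δ + (N:ℝ)^(-(1/2):ℝ))) :=
    (zsummable0 (x := 1/2) (by norm_num)).hasSum.mul_right _
  have hN0 : (0:ℝ) < N := by exact_mod_cast NeZero.pos N
  have h4 := tsum_of_norm_bounded h3 (f := fun n => (if n ∈ (Finset.range N).filter (fun n => n.Coprime N) then (ww δ n)^2 else 0)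
     - (if n.Coprime N then (ArithmeticFunction.moebius n : ℝ)^2 / (n:ℝ)^2 else 0)) ?_
  · rw [h2.tsum_eq] at h4
    refine h4.trans ?_
    gcongr
    exact (ztsum0 (x := 1/2) (by norm_num)).trans (by norm_num)
  intro n
  have hR : 0 ≤ (n:ℝ)^(-1-(1/2):ℝ) * (4 * δ + (N:ℝ)^(-(1/2):ℝ)) := by positivity
  by_cases hc : n.Coprime N
  swap
  · simp only [Finset.mem_filter, hc, and_false, if_false, sub_zero, norm_zero]; exact hR
  rcases Nat.eq_zero_or_pos n with rfl | hn
  · simpa [ww] using hR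
  have hn1 : (1:ℝ) ≤ n := by exact_mod_cast hn
  have hn0 : (0:ℝ) < n := by linarith
  have hsq : (n:ℝ)^2 = (n:ℝ)^(2:ℝ) := by norm_cast
  have hinv : 1/(n:ℝ)^2 = (n:ℝ)^(-2:ℝ) := by rw [hsq, Real.rpow_neg hn0.le]; simp
  by_cases hlt : n < N
  · rw [if_pos (Finset.mem_filter.2 ⟨Finset.mem_range.2 hlt, hc⟩), if_pos hc]
    have e : (ww δ n)^2 - (ArithmeticFunction.moebius n : ℝ)^2 / (n:ℝ)^2 =
       -((ArithmeticFunction.moebius n : ℝ)^2 * ((n:ℝ)^(-2:ℝ) * (1 - (n:ℝ)^(-(2*δ))))) := by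
      unfold ww
      have : ((n:ℝ)^(-1-δ))^2 = (n:ℝ)^(-2:ℝ) * (n:ℝ)^(-(2*δ)) := by
        rw [← Real.rpow_natCast, ← Real.rpow_mul hn0.le, ← Real.rpow_add hn0]
        congr 1; push_cast; ring
      rw [mul_pow, this, ← hinv]; ring
    rw [e, norm_neg, Real.norm_eq_abs]
    have hle1 : (n:ℝ)^(-(2*δ)) ≤ 1 := Real.rpow_le_one_of_one_le_of_nonpos hn1 (by linarith)
    rw [abs_of_nonneg (mul_nonneg (sq_nonneg _) (mul_nonneg (by positivity) (by linarith)))]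
    have h5 : 1 - (n:ℝ)^(-(2*δ)) ≤ 2 * δ * Real.log n := by
      rw [Real.rpow_def_of_pos hn0]
      have := Real.add_one_le_exp (Real.log n * (-(2*δ)))
      linarith
    have h6 : Real.log n ≤ 2 * (n:ℝ)^(1/2:ℝ) := by
      have := Real.log_le_rpow_div hn0.le (show (0:ℝ) < 1/2 by norm_num)
      linarith
    calc _ ≤ 1 * ((n:ℝ)^(-2:ℝ) * (2 * δ * (2 * (n:ℝ)^(1/2:ℝ)))) := by
          gcongr
          · exact mu_sq_le n
          · exact h5.trans (by gcongr)
      _ = ((n:ℝ)^(-2:ℝ) * (n:ℝ)^(1/2:ℝ)) * (4 * δ) := by ring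
      _ = (n:ℝ)^(-1-(1/2):ℝ) * (4 * δ) := by
          rw [← Real.rpow_add hn0]; norm_num
      _ ≤ _ := by
          gcongr
          have : 0 ≤ (N:ℝ)^(-(1/2):ℝ) := by positivity
          linarith
  · rw [if_neg (fun h => hlt (Finset.mem_range.1 (Finset.mem_filter.1 h).1)), if_pos hc, zero_sub, norm_neg]
    push Not at hlt
    have hlt' : (N:ℝ) ≤ n := by exact_mod_cast hlt
    rw [Real.norm_eq_abs, abs_of_nonneg (by positivity)]
    calc _ ≤ 1/(n:ℝ)^2 := by gcongr; exact mu_sq_le n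
      _ = (n:ℝ)^(-1-(1/2):ℝ) * (n:ℝ)^(-(1/2):ℝ) := by rw [hinv, ← Real.rpow_add hn0]; norm_num
      _ ≤ (n:ℝ)^(-1-(1/2):ℝ) * (N:ℝ)^(-(1/2):ℝ) := by
          gcongr ?_ * ?_
          exact Real.rpow_le_rpow_of_nonpos hN0 hlt' (by norm_num)
      _ ≤ _ := by
          gcongr
          linarith

lemma GG_sum {N : ℕ} [NeZero N] (hN2 : 2 ≤ N) {δ : ℝ} (hδ : 0 < δ) :
    |∑ u, (GG N δ u)^2 - 1/2 * ∑ u : (ZMod N)ˣ, (ww δ (u : ZMod N).val)^2| ≤ 5 * (1 + 1/δ)^2 / N := by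
  have hN0 : (0:ℝ) < N := by positivity
  set W := 1 + 1/δ with hW
  have hW1 : 1 ≤ W := by rw [hW]; have : 0 < 1/δ := by positivity
                         linarith
  have h := quad (fun u : (ZMod N)ˣ => ww δ (u : ZMod N).val) (GG N δ) (Equiv.neg _) (η := W / N)
    (b := 2 / N) (W := W) (by positivity) (by positivity) ?_ ?_ ?_
  · refine h.trans ?_
    have hc : (Fintype.card (ZMod N)ˣ : ℝ) ≤ N := by
      rw [ZMod.card_units_eq_totient]; exact_mod_cast Nat.totient_le N
    calc _ ≤ (2 * (W/N) + 2/N) * W + N * (W/N)^2 := by gcongr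
      _ = (3 * W^2 + 2 * W) / N := by field_simp; ring
      _ ≤ _ := by gcongr; nlinarith
  · intro u
    simp only [GG, Equiv.neg_apply]
    have h1 := gg_approx hδ (u : ZMod N)
    have h2 := gg_approx hδ ((-u : (ZMod N)ˣ) : ZMod N)
    rw [← hW, abs_le] at h1 h2
    rw [abs_le]
    constructor <;> linarith [h1.1, h1.2, h2.1, h2.2]
  · intro u
    simp only [Equiv.neg_apply]
    haveI : Fact (1 < N) := ⟨by omega⟩
    set v := (u : ZMod N).val with hv
    have hu0 : (u : ZMod N) ≠ 0 := u.ne_zero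
    have hneg : ((-u : (ZMod N)ˣ) : ZMod N).val = N - v := by
      rw [Units.val_neg, ZMod.neg_val, if_neg hu0]
    have hvN : v < N := ZMod.val_lt _
    have hv1 : 1 ≤ v := by
      rw [Nat.one_le_iff_ne_zero]; simpa [hv] using hu0
    rw [hneg]
    have hb : ∀ n : ℕ, N ≤ 2 * n → |ww δ n| ≤ 2 / N := by
      intro n hn
      have hn0 : 0 < n := by omega
      have hn0' : (0:ℝ) < n := by exact_mod_cast hn0
      have hn' : (N:ℝ) ≤ 2 * n := by exact_mod_cast hn
      refine (ww_le δ n).trans ?_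
      calc (n:ℝ)^(-1-δ) ≤ (n:ℝ)^(-1:ℝ) := Real.rpow_le_rpow_of_exponent_le (by exact_mod_cast hn0) (by linarith)
        _ = 1 / n := by rw [Real.rpow_neg_one]; simp
        _ ≤ 2 / N := by rw [div_le_div_iff₀ hn0' hN0]; linarith
    rw [abs_mul]
    have hbp : (0:ℝ) ≤ 2 / N := by positivity
    rcases le_or_gt N (2 * v) with h1 | h1
    · calc _ ≤ 2 / N * |ww δ (N - v)| := by gcongr; exact hb _ h1
        _ ≤ _ := by gcongr; linarith [abs_nonneg (ww δ v)]
    · calc _ ≤ |ww δ v| * (2 / N) := by gcongr; exact hb _ (by omega)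
        _ = 2 / N * |ww δ v| := by ring
        _ ≤ _ := by gcongr; linarith [abs_nonneg (ww δ (N - v))]
  · rw [units_sum (fun n => |ww δ n|)]
    refine ((ww_abs_summable hδ).sum_le_tsum _ (fun _ _ => abs_nonneg _)).trans ?_
    exact ((ww_abs_summable hδ).tsum_le_tsum (ww_le δ) (zsummable0 hδ)).trans (ztsum0 hδ)

end NSM

namespace NSM
open MeasureTheory Set Filter Topology

lemma BB_pow (N : ℕ) [NeZero N] : (BB N)^240 = N := by
  unfold BB aa
  rw [← Real.rpow_natCast, ← Real.rpow_mul (by positivity)]; norm_num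

lemma inv_bound {N : ℕ} [NeZero N] (χ : DirichletCharacter ℂ N) {δ : ℝ} (hδ : 0 < δ) :
    1 / ‖LFunction χ (1 + δ)‖^2 ≤ (1 + 1/δ)^2 := by
  have h : ‖(LFunction χ (1 + δ))⁻¹‖ ≤ 1 + 1/δ := by
    rw [L_inv χ hδ]
    refine (tsum_of_norm_bounded (zsummable0 hδ).hasSum (fun n => ?_)).trans (ztsum0 hδ)
    rw [norm_mul, Complex.norm_real]
    calc _ ≤ 1 * |ww δ n| := by gcongr; exact χ.norm_le_one _; exact le_rfl
      _ ≤ _ := by rw [one_mul]; exact ww_le δ n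
  rw [norm_inv] at h
  calc 1 / ‖LFunction χ (1 + δ)‖^2 = (‖LFunction χ (1 + δ)‖⁻¹)^2 := by simp
    _ ≤ _ := by gcongr

open scoped Classical in
lemma LV : ∃ C > (0:ℝ), ∀ (N : ℕ) [NeZero N], 2 ≤ N →
    (Finset.univ.filter fun χ : DirichletCharacter ℂ N => χ^2 = 1).card ≤ 4 →
    |∑ χ : DirichletCharacter ℂ N, (if χ.Even ∧ χ^2 ≠ 1 then 1 / ‖LFunction χ 1‖^2 else 0)
      - N.totient / 2 * AN N| ≤ C * N / BB N := by
  obtain ⟨κ, hκ, hκ1, C1, hC1, hMD⟩ := MD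
  refine ⟨C1 + 36/κ^2 + 8, by positivity, ?_⟩
  intro N _ hN hcard
  set B := BB N with hB
  have hB1 : 1 ≤ B := BB_ge_one N
  have hB0 : 0 < B := by linarith
  have hBN : B^240 = N := BB_pow N
  set δ : ℝ := κ / B^24 with hδ
  have hδ0 : 0 < δ := by positivity
  have hN0 : (0:ℝ) < N := by positivity
  set W := 1 + 1/δ with hW
  have hWle : W^2 ≤ 4/κ^2 * B^239 := by
    have h1 : 1 ≤ 1/δ := by
      rw [hδ, one_div_div, le_div_iff₀ hκ]
      calc 1 * κ ≤ 1 := by linarith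
        _ ≤ B^24 := one_le_pow₀ hB1
    have h2 : W ≤ 2 * B^24 / κ := by
      rw [hW]
      calc 1 + 1/δ ≤ 2 * (1/δ) := by linarith
        _ = _ := by rw [hδ]; field_simp
    have h3 : 0 ≤ W := by rw [hW]; positivity
    calc W^2 ≤ (2 * B^24/κ)^2 := by gcongr
      _ = 4/κ^2 * B^48 := by ring
      _ ≤ _ := by gcongr; norm_num
  have hNB : (N:ℝ) / B = B^239 := by rw [← hBN]; field_simp
  have hφ : (N.totient : ℝ) ≤ N := by exact_mod_cast Nat.totient_le N
  have hE := even_sum (N := N) hδ0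
  set E := ∑ χ : DirichletCharacter ℂ N, (if χ.Even then 1 / ‖LFunction χ (1 + δ)‖^2 else 0) with hEdef
  have h1 := GG_sum hN hδ0
  have h2 := diag (N := N) hδ0
  rw [← hW] at h1
  have hE2 : |E - N.totient / 2 * AN N| ≤ 20/κ^2 * B^239 + 8 * B^239 := by
    have e : E - N.totient / 2 * AN N = N.totient * ((∑ u, (GG N δ u)^2 - 1/2 * ∑ u : (ZMod N)ˣ, (ww δ (u : ZMod N).val)^2)
       + 1/2 * (∑ u : (ZMod N)ˣ, (ww δ (u : ZMod N).val)^2 - AN N)) := by rw [hE]; ring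
    have hhalf : (N:ℝ)^(-(1/2):ℝ) = 1 / B^120 := by
      rw [← hBN, ← Real.rpow_natCast, ← Real.rpow_mul hB0.le, ← Real.rpow_natCast B 120, one_div ((B:ℝ) ^ (_:ℝ)), ← Real.rpow_neg hB0.le]
      norm_num
    rw [e, abs_mul, abs_of_nonneg (by positivity)]
    calc _ ≤ N * (5 * W^2 / N + 1/2 * (3 * (4 * δ + (N:ℝ)^(-(1/2):ℝ)))) := by
          gcongr
          refine (abs_add_le _ _).trans (add_le_add h1 ?_)
          rw [abs_mul, abs_of_pos (by norm_num : (0:ℝ) < 1/2)]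
          gcongr
      _ = 5 * W^2 + 6 * (N * δ) + 3/2 * (N * (1 / B^120)) := by
          rw [hhalf]; field_simp; ring
      _ ≤ 5 * (4/κ^2 * B^239) + 6 * B^239 + 3/2 * B^239 := by
          have a1 : N * δ ≤ B^239 := by
            rw [hδ, ← hBN]
            calc B^240 * (κ/B^24) ≤ B^240 * (1 / B^24) := by gcongr
              _ = B^216 := by field_simp
              _ ≤ B^239 := by gcongr; norm_num
          have a2 : N * (1 / B^120) ≤ B^239 := by
            rw [← hBN]
            calc B^240 * (1/B^120) = B^120 := by field_simp
              _ ≤ B^239 := by gcongr; norm_num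
          linarith
      _ ≤ _ := by
          have : 0 < B^239 := by positivity
          ring_nf
          nlinarith
  have hT : |∑ χ : DirichletCharacter ℂ N, (if χ.Even ∧ χ^2 ≠ 1 then 1 / ‖LFunction χ 1‖^2 else 0) - E| ≤
      C1 * B^239 + 16/κ^2 * B^239 := by
    rw [hEdef, ← Finset.sum_sub_distrib]
    have h3 : ∀ χ : DirichletCharacter ℂ N, |(if χ.Even ∧ χ^2 ≠ 1 then 1 / ‖LFunction χ 1‖^2 else 0) -
        (if χ.Even then 1 / ‖LFunction χ (1 + δ)‖^2 else 0)| ≤ C1 / B + (if χ^2 = 1 then W^2 else 0) := by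
      intro χ
      have hC1B : 0 ≤ C1 / B := by positivity
      by_cases he : χ.Even
      · by_cases h2 : χ^2 = 1
        · simp only [he, h2, ne_eq, not_true, and_false, if_false, if_true, zero_sub, abs_neg]
          have := inv_bound χ hδ0
          rw [abs_of_nonneg (by positivity)]
          linarith
        · simp only [he, h2, ne_eq, not_false_iff, and_self, if_true, if_false, add_zero]
          exact hMD N χ h2
      · simp only [he, false_and, if_false, sub_zero, abs_zero]
        split_ifs <;> positivity
    refine (Finset.abs_sum_le_sum_abs _ _).trans ((Finset.sum_le_sum fun χ _ => h3 χ).trans ?_)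
    rw [Finset.sum_add_distrib, ← Finset.sum_filter]
    simp only [Finset.sum_const, nsmul_eq_mul, Finset.card_univ]
    have hc : (Fintype.card (DirichletCharacter ℂ N) : ℝ) ≤ N := by
      rw [← Nat.card_eq_fintype_card, card_eq_totient_of_hasEnoughRootsOfUnity]; exact hφ
    have hc4 : ((Finset.univ.filter fun χ : DirichletCharacter ℂ N => χ^2 = 1).card : ℝ) ≤ 4 := by exact_mod_cast hcard
    calc _ ≤ N * (C1 / B) + 4 * (4/κ^2 * B^239) := by gcongr
      _ = C1 * (N / B) + 16/κ^2 * B^239 := by ring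
      _ = _ := by rw [hNB]
  have h5 : (C1 + 36/κ^2 + 8) * N / B = C1 * B^239 + 36/κ^2 * B^239 + 8 * B^239 := by
    rw [mul_div_assoc, hNB]; ring
  rw [h5]
  have e2 := (abs_add_le (∑ χ : DirichletCharacter ℂ N, (if χ.Even ∧ χ^2 ≠ 1 then 1 / ‖LFunction χ 1‖^2 else 0) - E)
    (E - N.totient / 2 * AN N)).trans (add_le_add hT hE2)
  rw [sub_add_sub_cancel] at e2
  refine e2.trans (le_of_eq ?_)
  ring

end NSM

namespace NSM
open MeasureTheory Set Filter Topology

lemma AN_one_mul : ((AN 1 : ℝ) : ℂ) * riemannZeta 4 = riemannZeta 2 := by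
  set f : ℕ → ℂ := fun n => (((ArithmeticFunction.moebius n : ℝ)^2 / (n:ℝ)^2 : ℝ) : ℂ) with hf
  have hAN : ((AN 1 : ℝ) : ℂ) = ∑' n, f n := by
    unfold AN
    rw [Complex.ofReal_tsum]
    refine tsum_congr fun n => ?_
    simp [hf]
  have hsum : Summable (fun n => ‖f n‖) := by
    have := AN_summable 1
    refine this.congr fun n => ?_
    simp only [hf, Nat.coprime_one_right_eq_true, if_true, Complex.norm_real]
    rw [Real.norm_eq_abs, abs_of_nonneg (by positivity)]
  have h1 := EulerProduct.eulerProduct_hasProd (f := f) (by simp [hf]) (by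
    intro m n hmn
    simp only [hf]
    rw [ArithmeticFunction.isMultiplicative_moebius.map_mul_of_coprime hmn]
    push_cast; ring) hsum (by simp [hf])
  have h4 := riemannZeta_eulerProduct_hasProd (s := 4) (by norm_num)
  have h2 := riemannZeta_eulerProduct_hasProd (s := 2) (by norm_num)
  have h3 := h1.mul h4
  rw [hAN]
  refine h3.unique (h2.congr_fun fun p => ?_)
  have hp := p.prop
  have hp0 : ((p:ℕ):ℂ) ≠ 0 := by exact_mod_cast hp.ne_zero
  have hts : ∑' e, f ((p:ℕ)^e) = 1 + 1 / ((p:ℕ):ℂ)^2 := by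
    rw [tsum_eq_sum (s := Finset.range 2)]
    · simp [Finset.sum_range_succ, hf, ArithmeticFunction.moebius_apply_prime hp]
    · intro e he
      have he2 : 2 ≤ e := by
        have := Finset.mem_range.not.1 he
        omega
      have : ArithmeticFunction.moebius ((p:ℕ)^e) = 0 := by
        rw [ArithmeticFunction.moebius_apply_prime_pow hp (by omega), if_neg (by omega)]
      simp [hf, this]
  rw [hts]
  have e2 : ((p:ℕ):ℂ)^(-2:ℂ) = 1/((p:ℕ):ℂ)^2 := by
    rw [Complex.cpow_neg, one_div]; norm_cast
  have e4 : ((p:ℕ):ℂ)^(-4:ℂ) = 1/((p:ℕ):ℂ)^4 := by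
    rw [Complex.cpow_neg, one_div]; norm_cast
  rw [e2, e4]
  have hp2 : (2:ℝ) ≤ (p:ℕ) := by exact_mod_cast hp.two_le
  have hx1 : (1:ℂ) - 1/((p:ℕ):ℂ)^2 ≠ 0 := by
    rw [sub_ne_zero]
    intro h
    have h' : ((1:ℝ):ℂ) = ((1/((p:ℕ):ℝ)^2 : ℝ):ℂ) := by push_cast; exact h
    have := Complex.ofReal_injective h'
    rw [eq_div_iff (by positivity)] at this
    nlinarith
  have hx2 : (1:ℂ) + 1/((p:ℕ):ℂ)^2 ≠ 0 := by
    intro h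
    have h' : ((1 + 1/((p:ℕ):ℝ)^2 : ℝ):ℂ) = ((0:ℝ):ℂ) := by push_cast; exact h
    have h3 := Complex.ofReal_injective h'
    have : 0 < 1/((p:ℕ):ℝ)^2 := by positivity
    linarith
  have hfac : (1:ℂ) - 1/((p:ℕ):ℂ)^4 = (1 - 1/((p:ℕ):ℂ)^2) * (1 + 1/((p:ℕ):ℂ)^2) := by ring
  rw [hfac, mul_inv, mul_left_comm, mul_inv_cancel₀ hx2, mul_one]

lemma AN_prime {p : ℕ} (hp : p.Prime) : AN p * (1 + 1/(p:ℝ)^2) = AN 1 := by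
  set F : ℕ → ℝ := fun n => (ArithmeticFunction.moebius n : ℝ)^2 / (n:ℝ)^2 with hF
  have hp0 : (p:ℝ) ≠ 0 := by exact_mod_cast hp.ne_zero
  have h1 : AN 1 = ∑' n, F n := by
    unfold AN; refine tsum_congr fun n => by simp [hF]
  have hsF : Summable F := (AN_summable 1).congr fun n => by simp [hF]
  have hs1 := AN_summable p
  have hinj : Function.Injective (fun m : ℕ => p * m) := fun a b h => Nat.eq_of_mul_eq_mul_left hp.pos h
  have hsplit : ∀ n, F n = (if n.Coprime p then F n else 0) + (if p ∣ n then F n else 0) := by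
    intro n
    by_cases h : p ∣ n
    · have : ¬ n.Coprime p := by rw [Nat.coprime_comm, hp.coprime_iff_not_dvd]; simpa using h
      rw [if_neg this, if_pos h, zero_add]
    · have : n.Coprime p := by rw [Nat.coprime_comm, hp.coprime_iff_not_dvd]; exact h
      rw [if_pos this, if_neg h, add_zero]
  have hs2 : Summable (fun n => if p ∣ n then F n else 0) := by
    refine Summable.of_nonneg_of_le (fun n => ?_) (fun n => ?_) hsF
    · split_ifs
      · simp only [hF]; positivity
      · exact le_rfl
    · split_ifs
      · exact le_rfl
      · simp only [hF]; positivity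
  have h2 : ∑' n, (if p ∣ n then F n else 0) = AN p * (1/(p:ℝ)^2) := by
    rw [← hinj.tsum_eq]
    · unfold AN
      rw [← tsum_mul_right]
      refine tsum_congr fun m => ?_
      rw [if_pos (Dvd.intro _ rfl)]
      by_cases hc : m.Coprime p
      · rw [if_pos hc]
        simp only [hF]
        rw [ArithmeticFunction.isMultiplicative_moebius.map_mul_of_coprime hc.symm,
          ArithmeticFunction.moebius_apply_prime hp]
        push_cast
        rcases eq_or_ne (m:ℝ) 0 with hm | hm
        · simp [hm]
        field_simp
      · rw [if_neg hc]
        have hd : p ∣ m := by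
          by_contra h; exact hc (by rw [Nat.coprime_comm, hp.coprime_iff_not_dvd]; exact h)
        have : ArithmeticFunction.moebius (p * m) = 0 := by
          apply ArithmeticFunction.moebius_eq_zero_of_not_squarefree
          intro hsq
          obtain ⟨c, rfl⟩ := hd
          have := hsq p ⟨c, by ring⟩
          exact hp.one_lt.ne' (Nat.isUnit_iff.1 this)
        simp [hF, this]
    · intro n hn
      have : p ∣ n := by by_contra h; simp [h] at hn
      obtain ⟨m, rfl⟩ := this
      exact ⟨m, rfl⟩
  rw [h1, tsum_congr hsplit, hs1.tsum_add hs2, h2]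
  unfold AN
  ring

lemma AN_pow {p j : ℕ} (hj : 1 ≤ j) : AN (p^j) = AN p := by
  unfold AN
  refine tsum_congr fun n => ?_
  have : n.Coprime (p^j) ↔ n.Coprime p := Nat.coprime_pow_right_iff (by omega) n p
  by_cases h : n.Coprime p
  · rw [if_pos h, if_pos (this.2 h)]
  · rw [if_neg h, if_neg (fun h' => h (this.1 h'))]

lemma AN_eq {p j : ℕ} (hp : p.Prime) (hj : 1 ≤ j) :
    AN (p^j) = 2 * (riemannZeta 2 / (2 * riemannZeta 4)).re * ((p:ℝ)^2 / ((p:ℝ)^2 + 1)) := by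
  have h4 : riemannZeta 4 ≠ 0 := riemannZeta_ne_zero_of_one_le_re (by norm_num)
  have h1 : riemannZeta 2 / (2 * riemannZeta 4) = ((AN 1 / 2 : ℝ) : ℂ) := by
    rw [← AN_one_mul]; push_cast; field_simp
  have hp0 : (p:ℝ) ≠ 0 := by exact_mod_cast hp.ne_zero
  have hpp : (p:ℝ)^2 + 1 ≠ 0 := by positivity
  rw [AN_pow hj, h1, Complex.ofReal_re, ← AN_prime hp]
  field_simp

end NSM

namespace NSM
open MeasureTheory Set Filter Topology

lemma two_pow_sq (j : ℕ) (x : ZMod (2^(j+1))) (hx : x^2 = 1) :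
    x ∈ ({1, -1, 1 + 2^j, -1 + 2^j} : Finset (ZMod (2^(j+1)))) := by
  obtain ⟨a, rfl⟩ := ZMod.intCast_surjective x
  have h1 : ((2^(j+1) : ℕ) : ℤ) ∣ a^2 - 1 := by
    rw [← ZMod.intCast_zmod_eq_zero_iff_dvd]
    push_cast; rw [hx]; simp
  have hodd : a % 2 = 1 := by
    have : (2:ℤ) ∣ a^2 - 1 := dvd_trans ⟨2^j, by push_cast; ring⟩ h1
    rcases Int.emod_two_eq_zero_or_one a with h | h
    · exfalso
      obtain ⟨b, hb⟩ := Int.dvd_of_emod_eq_zero h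
      obtain ⟨c, hc⟩ := this
      rw [hb] at hc
      have : 1 = 2 * (2 * b^2 - c) := by linarith
      omega
    · exact h
  obtain ⟨b, hb⟩ : ∃ b, a = 2 * b + 1 := ⟨a/2, by omega⟩
  have key : ∀ (d : ℤ) , (2^j : ℤ) ∣ d → ((d : ℤ) : ZMod (2^(j+1))) = 0 ∨ ((d : ℤ) : ZMod (2^(j+1))) = 2^j := by
    rintro d ⟨c, rfl⟩
    have h0 : ((2:ZMod (2^(j+1)))^j) * 2 = 0 := by
      rw [← pow_succ]
      have := ZMod.natCast_self (2^(j+1))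
      push_cast at this; exact this
    rcases Int.even_or_odd' c with ⟨e, h | h⟩
    · left; rw [h]; push_cast; rw [← mul_assoc, h0, zero_mul]
    · right; rw [h]; push_cast; rw [mul_add, ← mul_assoc, h0, zero_mul]; ring
  have h2 : (2^(j+1) : ℤ) ∣ 4 * (b * (b+1)) := by
    have := h1; rw [hb] at this; push_cast at this; convert! this using 1; ring
  have hb2 : b % 2 = 0 ∨ b % 2 = 1 := Int.emod_two_eq_zero_or_one b
  have h3 : (2^j : ℤ) ∣ 2 * (b * (b+1)) := by
    obtain ⟨c, hc⟩ := h2; exact ⟨c, by rw [pow_succ] at hc; linarith⟩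
  rcases hb2 with h | h
  · have hco : IsCoprime ((2:ℤ)^j) (b+1) := by
      apply IsCoprime.pow_left
      obtain ⟨e, he⟩ := Int.dvd_of_emod_eq_zero h
      exact ⟨-e, 1, by rw [he]; ring⟩
    have h4 : (2^j : ℤ) ∣ 2 * b := by
      apply hco.dvd_of_dvd_mul_right; convert! h3 using 1; ring
    have := key _ h4
    have e : (a : ZMod (2^(j+1))) = ((2*b : ℤ) : ZMod (2^(j+1))) + 1 := by rw [hb]; push_cast; ring
    rw [e]
    rcases this with h | h <;> rw [h]
    · simp
    · simp [add_comm]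
  · have hco : IsCoprime ((2:ℤ)^j) b := by
      apply IsCoprime.pow_left
      exact ⟨-(b/2), 1, by omega⟩
    have h4 : (2^j : ℤ) ∣ 2 * (b+1) := by
      apply hco.dvd_of_dvd_mul_right; convert! h3 using 1; ring
    have := key _ h4
    have e : (a : ZMod (2^(j+1))) = ((2*(b+1) : ℤ) : ZMod (2^(j+1))) + (-1) := by rw [hb]; push_cast; ring
    rw [e]
    rcases this with h | h <;> rw [h]
    · simp
    · simp [add_comm]

open scoped Classical in
lemma count_units {p j : ℕ} (hp : p.Prime) [NeZero (p^j)] (hj : 1 ≤ j) :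
    (Finset.univ.filter fun u : (ZMod (p^j))ˣ => u^2 = 1).card ≤ 4 := by
  rcases eq_or_ne p 2 with rfl | h2
  · obtain ⟨i, rfl⟩ : ∃ i, j = i + 1 := ⟨j-1, by omega⟩
    refine le_trans (Finset.card_le_card_of_injOn (fun u => (u : ZMod (2^(i+1))))
      (t := {1, -1, 1 + 2^i, -1 + 2^i}) ?_ ?_) Finset.card_le_four
    · intro u hu
      have hu' : u^2 = 1 := by simpa using hu
      have := two_pow_sq i (u : ZMod (2^(i+1))) (by rw [← Units.val_pow_eq_pow_val, hu', Units.val_one])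
      exact this
    · intro u _ v _ h
      exact Units.ext h
  · have := ZMod.isCyclic_units_of_prime_pow p hp h2 j
    have := IsCyclic.card_pow_eq_one_le (α := (ZMod (p^j))ˣ) (n := 2) (by norm_num)
    refine le_trans ?_ (le_trans this (by norm_num))
    apply le_of_eq
    congr

open scoped Classical in
lemma count_real {p j : ℕ} (hp : p.Prime) [NeZero (p^j)] (hj : 1 ≤ j) :
    (Finset.univ.filter fun χ : DirichletCharacter ℂ (p^j) => χ^2 = 1).card ≤ 4 := by
  obtain ⟨e⟩ := DirichletCharacter.mulEquiv_units ℂ (p^j)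
  refine le_trans (Finset.card_le_card_of_injOn (fun χ => e χ)
      (t := Finset.univ.filter fun u : (ZMod (p^j))ˣ => u^2 = 1) ?_ ?_) (count_units hp hj)
  · intro χ hχ
    have h : χ^2 = 1 := by simpa using hχ
    simp only [Finset.coe_filter, Finset.mem_univ, true_and, Set.mem_ofPred_eq]
    rw [← map_pow, h, map_one]
  · intro a _ b _ h
    exact e.injective h

lemma changeLevel_even {M N : ℕ} [NeZero N] (h : M ∣ N) (χ : DirichletCharacter ℂ M) :
    (changeLevel h χ).Even ↔ χ.Even := by
  unfold DirichletCharacter.Even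
  have := changeLevel_eq_cast_of_dvd χ h (-1)
  simp only [Units.val_neg, Units.val_one] at this
  rw [this]
  have : (ZMod.cast (-1 : ZMod N) : ZMod M) = -1 := by
    have := map_neg (ZMod.castHom h (ZMod M)) 1
    rw [map_one] at this
    exact this
  rw [this]

lemma LFunction_lift {p j k : ℕ} (hp : p.Prime) [NeZero (p^j)] [NeZero (p^k)] (hj : 1 ≤ j) (h : p^j ∣ p^k)
    (χ : DirichletCharacter ℂ (p^j)) (hχ : χ ≠ 1) :
    LFunction (changeLevel h χ) 1 = LFunction χ 1 := by
  rw [LFunction_changeLevel h χ (Or.inl hχ)]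
  rw [Finset.prod_eq_one, mul_one]
  intro q hq
  have hq' := Nat.prime_of_mem_primeFactors hq
  have hqp : q = p := (Nat.prime_dvd_prime_iff_eq hq' hp).1 (hq'.dvd_of_dvd_pow (Nat.dvd_of_mem_primeFactors hq))
  rw [hqp]
  have : χ (p : ZMod (p^j)) = 0 := by
    apply χ.map_nonunit
    rw [ZMod.isUnit_iff_coprime, Nat.coprime_pow_right_iff (by omega), Nat.coprime_self]
    exact hp.one_lt.ne'
  rw [this]; simp

open scoped Classical in
/-- second moment over even complex characters -/
noncomputable def TT (N : ℕ) [NeZero N] : ℝ :=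
  ∑ χ : DirichletCharacter ℂ N, if χ.Even ∧ χ^2 ≠ 1 then 1/‖LFunction χ 1‖^2 else 0

open scoped Classical in
lemma transfer {p j k : ℕ} (hp : p.Prime) [NeZero (p^j)] [NeZero (p^k)] (hj : 1 ≤ j) (h : p^j ∣ p^k) :
    (∑ χ : DirichletCharacter ℂ (p^k), if (χ.Even ∧ χ^2 ≠ 1) ∧ χ.conductor ∣ p^j then
      1/‖LFunction χ 1‖^2 else 0) = TT (p^j) := by
  unfold TT
  rw [← Finset.sum_filter, ← Finset.sum_filter]
  symm
  have hsq : ∀ χ : DirichletCharacter ℂ (p^j), (changeLevel h χ)^2 = 1 ↔ χ^2 = 1 := by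
    intro χ
    rw [← map_pow, changeLevel_eq_one_iff]
  refine Finset.sum_bij (fun χ _ => changeLevel h χ) ?_ ?_ ?_ ?_
  · intro χ hχ
    simp only [Finset.mem_filter, Finset.mem_univ, true_and] at hχ ⊢
    refine ⟨⟨(changeLevel_even h χ).2 hχ.1, fun h' => hχ.2 ((hsq χ).1 h')⟩, ?_⟩
    exact conductor_dvd_of_mem_conductorSet _ (changeLevel_factorsThrough χ h)
  · intro a _ b _ hab
    exact changeLevel_injective h hab
  · intro χ hχ
    simp only [Finset.mem_filter, Finset.mem_univ, true_and] at hχ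
    have hf : FactorsThrough χ (p^j) := (mem_conductorSet_iff_conductor_dvd χ h).2 hχ.2
    have he := FactorsThrough.eq_changeLevel hf
    refine ⟨FactorsThrough.χ₀ hf, ?_, he.symm⟩
    simp only [Finset.mem_filter, Finset.mem_univ, true_and]
    rw [← changeLevel_even h, Ne, ← hsq]
    constructor
    · rw [← he]; exact hχ.1.1
    · have := hχ.1.2
      rw [he] at this; exact this
  · intro χ hχ
    simp only [Finset.mem_filter, Finset.mem_univ, true_and] at hχ
    have : χ ≠ 1 := by rintro rfl; exact hχ.2 (one_pow _)
    rw [LFunction_lift hp hj h χ this]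

lemma inv_pow_decomp {p : ℝ} (hp : 0 < p) (i k : ℕ) (hi : 1 ≤ i) (hik : i ≤ k) :
    1/p^i = 1/p^k + ∑ j ∈ Finset.Ico 1 k, if i ≤ j then (1/p^j) * (1 - 1/p) else 0 := by
  induction k, hik using Nat.le_induction with
  | base =>
    rw [Finset.sum_eq_zero, add_zero]
    intro j hj
    rw [Finset.mem_Ico] at hj
    rw [if_neg (by omega)]
  | succ n hn ih =>
    rw [Finset.sum_Ico_succ_top (by omega), if_pos hn, ih, pow_succ]
    have : 1/p^n = 1/(p^n*p) + 1/p^n*(1-1/p) := by field_simp; ring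
    linarith

open scoped Classical in
lemma complex_sum {p k : ℕ} (hp : p.Prime) [hN : ∀ j, NeZero (p^j)] (hk : 1 ≤ k) :
    (∑ χ : DirichletCharacter ℂ (p^k), if χ.Even ∧ χ^2 ≠ 1 then
      1/((χ.conductor:ℝ) * ‖LFunction χ 1‖^2) else 0) =
    1/(p:ℝ)^k * TT (p^k) + ∑ j ∈ Finset.Ico 1 k, (1/(p:ℝ)^j) * (1-1/(p:ℝ)) * TT (p^j) := by
  have h1 : ∀ j ∈ Finset.Ico 1 k, (1/(p:ℝ)^j) * (1-1/(p:ℝ)) * TT (p^j) =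
      ∑ χ : DirichletCharacter ℂ (p^k), if (χ.Even ∧ χ^2 ≠ 1) ∧ χ.conductor ∣ p^j then
      (1/(p:ℝ)^j) * (1-1/(p:ℝ)) * (1/‖LFunction χ 1‖^2) else 0 := by
    intro j hj
    rw [Finset.mem_Ico] at hj
    rw [← transfer hp hj.1 (pow_dvd_pow p hj.2.le), Finset.mul_sum]
    refine Finset.sum_congr rfl fun χ _ => ?_
    rw [mul_ite, mul_zero]
  rw [Finset.sum_congr rfl h1, Finset.sum_comm]
  unfold TT
  rw [Finset.mul_sum, ← Finset.sum_add_distrib]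
  refine Finset.sum_congr rfl fun χ _ => ?_
  by_cases hχ : χ.Even ∧ χ^2 ≠ 1
  · rw [if_pos hχ, if_pos hχ]
    obtain ⟨i, hik, hi⟩ := (Nat.dvd_prime_pow hp).1 (conductor_dvd_level χ)
    have hi1 : 1 ≤ i := by
      by_contra h0
      have : i = 0 := by omega
      rw [this, pow_zero] at hi
      have := eq_one_iff_conductor_eq_one.2 hi
      exact hχ.2 (by rw [this, one_pow])
    have hp0 : (0:ℝ) < p := by exact_mod_cast hp.pos
    have hd := inv_pow_decomp hp0 i k hi1 hik
    rw [hi]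
    push_cast
    rw [← one_div_mul_one_div, hd, add_mul, Finset.sum_mul]
    congr 1
    refine Finset.sum_congr rfl fun j _ => ?_
    have : p^i ∣ p^j ↔ i ≤ j := Nat.pow_dvd_pow_iff_le_right hp.one_lt
    by_cases hij : i ≤ j
    · rw [if_pos hij, if_pos ⟨hχ, this.2 hij⟩]
    · rw [if_neg hij, if_neg (fun h => hij (this.1 h.2)), zero_mul]
  · rw [if_neg hχ, if_neg hχ, mul_zero, zero_add]
    symm
    apply Finset.sum_eq_zero
    intro j _
    rw [if_neg (fun h => hχ h.1)]

end NSM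

namespace NSM
open MeasureTheory Set Filter Topology

lemma loglog_lower {p k : ℕ} (hp : p.Prime) (hk : 1 ≤ k) :
    1/2000 ≤ (Real.log k + Real.log (Real.log p))^2 := by
  have hp2 : (2:ℝ) ≤ p := by exact_mod_cast hp.two_le
  have hk1 : (1:ℝ) ≤ k := by exact_mod_cast hk
  have hl : 0 < Real.log p := Real.log_pos (by linarith)
  have hl2 := Real.log_two_gt_d9
  have hl2' := Real.log_two_lt_d9
  have hlog2 : Real.log 2 ≤ Real.log p := Real.log_le_log (by norm_num) hp2
  rw [← Real.log_mul (by positivity) hl.ne']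
  set y := (k:ℝ) * Real.log p with hy
  have hy0 : 0 < y := by positivity
  have hcase : y ≤ 0.7 ∨ 1.03 ≤ y := by
    rcases Nat.lt_or_ge k 2 with h | h
    · have hk' : k = 1 := by omega
      rcases Nat.lt_or_ge p 3 with h3 | h3
      · have hp' : p = 2 := by have := hp.two_le; omega
        left; rw [hy, hk', hp']; push_cast; linarith
      · right
        have h9 : 3 * Real.log 2 ≤ 2 * Real.log 3 := by
          have e1 : Real.log ((2:ℝ)^3) = 3 * Real.log 2 := by rw [Real.log_pow]; norm_num
          have e2 : Real.log ((3:ℝ)^2) = 2 * Real.log 3 := by rw [Real.log_pow]; norm_num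
          rw [← e1, ← e2]
          exact Real.log_le_log (by norm_num) (by norm_num)
        have h3' : Real.log 3 ≤ Real.log p := Real.log_le_log (by norm_num) (by exact_mod_cast h3)
        rw [hy, hk']; push_cast; linarith
    · right
      have : (2:ℝ) ≤ k := by exact_mod_cast h
      nlinarith
  rcases hcase with h | h
  · have := Real.log_le_sub_one_of_pos hy0
    nlinarith
  · have := Real.one_sub_inv_le_log_of_pos hy0
    have h2 : y⁻¹ ≤ (1.03:ℝ)⁻¹ := inv_anti₀ (by norm_num) h
    have h3 : (0.029:ℝ) ≤ Real.log y := by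
      have : (0.029:ℝ) ≤ 1 - (1.03:ℝ)⁻¹ := by norm_num
      linarith
    nlinarith

lemma geom_sum' {b : ℝ} (hb : 1 < b) (k : ℕ) (hk : 1 ≤ k) :
    1/b^k + ∑ j ∈ Finset.Ico 1 k, 1/b^j ≤ 1/(b-1) := by
  have hb1 : 0 < b - 1 := by linarith
  have hb0 : 0 < b := by linarith
  have key : 1/b^k + ∑ j ∈ Finset.Ico 1 k, 1/b^j + 1/(b^k*(b-1)) = 1/(b-1) := by
    induction k, hk using Nat.le_induction with
    | base => simp; field_simp; ring
    | succ n hn ih =>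
      rw [Finset.sum_Ico_succ_top hn, ← ih, pow_succ]
      have : 1/(b^n*(b-1)) = 1/(b^n*b) + 1/(b^n*b*(b-1)) := by field_simp; ring
      linarith
  have : 0 < 1/(b^k*(b-1)) := by positivity
  linarith

lemma BB_pow' (p j : ℕ) : BB (p^j) = (BB p)^j := by
  unfold BB
  push_cast
  rw [← Real.rpow_natCast, ← Real.rpow_natCast, ← Real.rpow_mul (by positivity), ← Real.rpow_mul (by positivity), mul_comm]

lemma BB_sub_one {p : ℕ} (hp : p.Prime) : Real.log p / 240 ≤ BB p - 1 := by
  have hp0 : (0:ℝ) < p := by exact_mod_cast hp.pos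
  unfold BB aa
  rw [Real.rpow_def_of_pos hp0]
  have := Real.add_one_le_exp (Real.log p * (1/240))
  linarith

open scoped Classical in
lemma complex_asymp : ∃ C > (0:ℝ), ∀ (p k : ℕ) (hp : p.Prime) [∀ j, NeZero (p^j)], 1 ≤ k →
    |(∑ χ : DirichletCharacter ℂ (p^k), if χ.Even ∧ χ^2 ≠ 1 then
      1/((χ.conductor:ℝ) * ‖LFunction χ 1‖^2) else 0) - (riemannZeta 2 / (2 * riemannZeta 4)).re *
          (((p : ℝ) - 1) ^ 2 / ((p : ℝ) ^ 2 + 1)) * k| ≤ C * (1/Real.log p) := by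
  obtain ⟨C, hC, hLV⟩ := LV
  refine ⟨240 * C + 1, by positivity, ?_⟩
  intro p k hp hN hk
  have hp2 : (2:ℝ) ≤ p := by exact_mod_cast hp.two_le
  have hp0 : (0:ℝ) < p := by linarith
  have hl : 0 < Real.log p := Real.log_pos (by linarith)
  set A := AN (p^1) with hA
  set Z := (riemannZeta 2 / (2 * riemannZeta 4)).re with hZ
  have hAeq : A = 2 * Z * ((p:ℝ)^2/((p:ℝ)^2+1)) := AN_eq hp le_rfl
  have hA2 := AN_le (p^1)
  rw [← hA] at hA2
  set b := BB p with hb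
  have hb1 := BB_sub_one hp
  rw [← hb] at hb1
  have hb1' : 1 < b := by
    have : 0 < Real.log p / 240 := by positivity
    linarith
  have hb0 : 0 < b := by linarith
  have hT : ∀ j, 1 ≤ j → |1/(p:ℝ)^j * TT (p^j) - (1-1/(p:ℝ))/2 * A| ≤ C * (1/b^j) := by
    intro j hj
    have h1 := hLV (p^j) (le_trans hp.two_le (Nat.le_self_pow (by omega) p)) (count_real hp hj)
    have h2 : AN (p^j) = A := by rw [hA, AN_pow hj, pow_one]
    change |TT (p^j) - _| ≤ _ at h1
    rw [h2, BB_pow'] at h1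
    have h3 : ((p^j).totient : ℝ) = (p:ℝ)^j * (1 - 1/(p:ℝ)) := by
      obtain ⟨i, rfl⟩ : ∃ i, j = i + 1 := ⟨j-1, by omega⟩
      rw [Nat.totient_prime_pow_succ hp]
      push_cast [Nat.cast_sub hp.one_le]
      rw [pow_succ]; field_simp
    rw [h3] at h1
    have hpj : (0:ℝ) < (p:ℝ)^j := by positivity
    have e : 1/(p:ℝ)^j * TT (p^j) - (1-1/(p:ℝ))/2 * A =
        1/(p:ℝ)^j * (TT (p^j) - (p:ℝ)^j * (1 - 1/(p:ℝ))/2 * A) := by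
      field_simp
    rw [e, abs_mul, abs_of_pos (by positivity : 0 < 1/(p:ℝ)^j)]
    calc _ ≤ 1/(p:ℝ)^j * (C * ((p^j:ℕ):ℝ) / b^j) := by gcongr
      _ = C * (1/b^j) := by push_cast; field_simp
  rw [complex_sum hp hk]
  have hx0 : 0 ≤ 1 - 1/(p:ℝ) := by
    have : 1/(p:ℝ) ≤ 1 := by rw [div_le_one hp0]; linarith
    linarith
  have hx1 : 1 - 1/(p:ℝ) ≤ 1 := by
    have : 0 < 1/(p:ℝ) := by positivity
    linarith
  have hcard : ∑ j ∈ Finset.Ico 1 k, (1-1/(p:ℝ)) * ((1-1/(p:ℝ))/2 * A) =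
      ((k:ℝ)-1) * ((1-1/(p:ℝ)) * ((1-1/(p:ℝ))/2 * A)) := by
    rw [Finset.sum_const, Nat.card_Ico, nsmul_eq_mul, Nat.cast_sub hk, Nat.cast_one]
  have hmain : (1-1/(p:ℝ))/2 * A + ((k:ℝ)-1) * ((1-1/(p:ℝ)) * ((1-1/(p:ℝ))/2 * A)) -
      Z * (((p : ℝ) - 1) ^ 2 / ((p : ℝ) ^ 2 + 1)) * k = (1-1/(p:ℝ)) * (A/2) * (1/(p:ℝ)) := by
    rw [hAeq]
    have : (p:ℝ)^2 + 1 ≠ 0 := by positivity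
    field_simp
    ring
  have hsplit : 1/(p:ℝ)^k * TT (p^k) + ∑ j ∈ Finset.Ico 1 k, (1/(p:ℝ)^j) * (1-1/(p:ℝ)) * TT (p^j)
      - Z * (((p : ℝ) - 1) ^ 2 / ((p : ℝ) ^ 2 + 1)) * k =
      (1/(p:ℝ)^k * TT (p^k) - (1-1/(p:ℝ))/2 * A) +
      ∑ j ∈ Finset.Ico 1 k, (1-1/(p:ℝ)) * (1/(p:ℝ)^j * TT (p^j) - (1-1/(p:ℝ))/2 * A) +
      (1-1/(p:ℝ)) * (A/2) * (1/(p:ℝ)) := by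
    rw [← hmain, ← hcard]
    simp only [mul_sub (1-1/(p:ℝ)), Finset.sum_sub_distrib]
    have : ∀ j ∈ Finset.Ico 1 k, (1/(p:ℝ)^j) * (1-1/(p:ℝ)) * TT (p^j) =
      (1-1/(p:ℝ)) * (1/(p:ℝ)^j * TT (p^j)) := fun j _ => by ring
    rw [Finset.sum_congr rfl this]
    ring
  rw [hsplit]
  have hS : |∑ j ∈ Finset.Ico 1 k, (1-1/(p:ℝ)) * (1/(p:ℝ)^j * TT (p^j) - (1-1/(p:ℝ))/2 * A)| ≤
      ∑ j ∈ Finset.Ico 1 k, C * (1/b^j) := by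
    refine le_trans (Finset.abs_sum_le_sum_abs _ _) (Finset.sum_le_sum fun j hj => ?_)
    rw [abs_mul, abs_of_nonneg hx0]
    have := hT j (Finset.mem_Ico.1 hj).1
    exact le_trans (mul_le_of_le_one_left (abs_nonneg _) hx1) this
  have hE : |(1-1/(p:ℝ)) * (A/2) * (1/(p:ℝ))| ≤ 1/Real.log p := by
    rw [abs_of_nonneg (mul_nonneg (mul_nonneg hx0 (by linarith)) (by positivity))]
    have h1 : (1-1/(p:ℝ)) * (A/2) ≤ 1 := mul_le_one₀ hx1 (by linarith) (by linarith)
    have h2 : 1/(p:ℝ) ≤ 1/Real.log p := by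
      apply one_div_le_one_div_of_le hl
      have := Real.log_le_sub_one_of_pos hp0
      linarith
    calc _ ≤ 1 * (1/(p:ℝ)) := by gcongr
      _ ≤ _ := by linarith
  have hG := geom_sum' hb1' k hk
  have hG2 : 1/(b-1) ≤ 240 * (1/Real.log p) := by
    have : 1/(b-1) ≤ 1/(Real.log p/240) := one_div_le_one_div_of_le (by positivity) hb1
    refine this.trans (le_of_eq ?_)
    field_simp
  have h1 := abs_add_le ((1/(p:ℝ)^k * TT (p^k) - (1-1/(p:ℝ))/2 * A) +
      ∑ j ∈ Finset.Ico 1 k, (1-1/(p:ℝ)) * (1/(p:ℝ)^j * TT (p^j) - (1-1/(p:ℝ))/2 * A))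
      ((1-1/(p:ℝ)) * (A/2) * (1/(p:ℝ)))
  have h2 := abs_add_le (1/(p:ℝ)^k * TT (p^k) - (1-1/(p:ℝ))/2 * A)
      (∑ j ∈ Finset.Ico 1 k, (1-1/(p:ℝ)) * (1/(p:ℝ)^j * TT (p^j) - (1-1/(p:ℝ))/2 * A))
  have h3 := hT k hk
  have hS2 : ∑ j ∈ Finset.Ico 1 k, C * (1/b^j) = C * ∑ j ∈ Finset.Ico 1 k, 1/b^j := (Finset.mul_sum _ _ _).symm
  have h4 : C * (1/b^k) + C * ∑ j ∈ Finset.Ico 1 k, 1/b^j ≤ C * (240 * (1/Real.log p)) := by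
    rw [← mul_add]
    exact mul_le_mul_of_nonneg_left (hG.trans hG2) hC.le
  have h5 : (240 * C + 1) * (1/Real.log p) = C * (240 * (1/Real.log p)) + 1/Real.log p := by ring
  rw [hS2] at hS
  linarith

open scoped Classical in
theorem final : ∃ c0 > (0 : ℝ), ∃ C > (0 : ℝ), ∀ (p k : ℕ) (hp : p.Prime) [∀ j, NeZero (p^j)], 1 ≤ k →
      (∀ χ : DirichletCharacter ℂ (p ^ k), χ ≠ 1 → ∀ β : ℝ,
          1 - c0 / Real.log (p ^ k : ℕ) ≤ β → χ.LFunction (β : ℂ) ≠ 0) →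
      |(∑ χ : DirichletCharacter ℂ (p ^ k),
          if χ ≠ 1 ∧ χ.Even then 1 / ((χ.conductor : ℝ) * ‖χ.LFunction 1‖ ^ 2) else 0) -
        (riemannZeta 2 / (2 * riemannZeta 4)).re *
          (((p : ℝ) - 1) ^ 2 / ((p : ℝ) ^ 2 + 1)) * k| ≤
      C * (1 / Real.log p) +
        C * k ^ 2 * (Real.log p) ^ 2 * (Real.log k + Real.log (Real.log p)) ^ 2 / p := by
  obtain ⟨c0, hc0, c, hc, hRC⟩ := RC
  obtain ⟨C1, hC1, hCA⟩ := complex_asymp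
  refine ⟨c0, hc0, C1 + 8000 / c^2, by positivity, ?_⟩
  intro p k hp hN hk hz
  have hp2 : (2:ℝ) ≤ p := by exact_mod_cast hp.two_le
  have hp0 : (0:ℝ) < p := by linarith
  have hl : 0 < Real.log p := Real.log_pos (by linarith)
  have hk0 : (0:ℝ) < k := by exact_mod_cast hk
  have h1 := hCA p k hp hk
  set q2 := (Real.log k + Real.log (Real.log p)) ^ 2 with hq2
  have hq : 1/2000 ≤ q2 := loglog_lower hp hk
  have hsplit : (∑ χ : DirichletCharacter ℂ (p ^ k),
          if χ ≠ 1 ∧ χ.Even then 1 / ((χ.conductor : ℝ) * ‖χ.LFunction 1‖ ^ 2) else 0) =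
      (∑ χ : DirichletCharacter ℂ (p^k), if χ.Even ∧ χ^2 ≠ 1 then
      1/((χ.conductor:ℝ) * ‖LFunction χ 1‖^2) else 0) +
      ∑ χ ∈ Finset.univ.filter (fun χ : DirichletCharacter ℂ (p^k) => χ^2 = 1), if χ ≠ 1 ∧ χ.Even then
        1 / ((χ.conductor : ℝ) * ‖χ.LFunction 1‖ ^ 2) else 0 := by
    rw [Finset.sum_filter, ← Finset.sum_add_distrib]
    refine Finset.sum_congr rfl fun χ _ => ?_
    by_cases h2 : χ^2 = 1
    · simp [h2]
    · have : χ ≠ 1 := by rintro rfl; exact h2 (one_pow _)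
      simp [h2, this]
  have hlogN : Real.log (p^k:ℕ) = k * Real.log p := by push_cast; rw [Real.log_pow]
  have hR : ∀ χ ∈ Finset.univ.filter (fun χ : DirichletCharacter ℂ (p^k) => χ^2 = 1),
      |if χ ≠ 1 ∧ χ.Even then 1 / ((χ.conductor : ℝ) * ‖χ.LFunction 1‖ ^ 2) else 0| ≤
        (k * Real.log p)^2 / (c^2 * p) := by
    intro χ hχ
    have h2 : χ^2 = 1 := (Finset.mem_filter.1 hχ).2
    by_cases h : χ ≠ 1 ∧ χ.Even
    · rw [if_pos h]
      have hL := hRC (p^k) χ (le_trans hp.two_le (Nat.le_self_pow (by omega) p)) h.1 h2 (hz χ h.1)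
      rw [hlogN] at hL
      obtain ⟨i, hik, hi⟩ := (Nat.dvd_prime_pow hp).1 (conductor_dvd_level χ)
      have hi1 : i ≠ 0 := by
        intro h0
        rw [h0, pow_zero] at hi
        exact h.1 (eq_one_iff_conductor_eq_one.2 hi)
      have hcon : (p:ℝ) ≤ χ.conductor := by
        rw [hi]; exact_mod_cast Nat.le_self_pow hi1 p
      rw [abs_of_nonneg (by positivity)]
      have hLp : 0 < c / (k * Real.log p) := by positivity
      calc 1 / ((χ.conductor : ℝ) * ‖χ.LFunction 1‖ ^ 2) ≤ 1 / ((p:ℝ) * (c / (k * Real.log p))^2) := by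
            gcongr
        _ = _ := by field_simp
    · rw [if_neg h, abs_zero]; positivity
  have hRs : |∑ χ ∈ Finset.univ.filter (fun χ : DirichletCharacter ℂ (p^k) => χ^2 = 1), if χ ≠ 1 ∧ χ.Even then
        1 / ((χ.conductor : ℝ) * ‖χ.LFunction 1‖ ^ 2) else 0| ≤ 4 * ((k * Real.log p)^2 / (c^2 * p)) := by
    refine le_trans (Finset.abs_sum_le_sum_abs _ _) (le_trans (Finset.sum_le_card_nsmul _ _ _ hR) ?_)
    rw [nsmul_eq_mul]
    have : ((Finset.univ.filter (fun χ : DirichletCharacter ℂ (p^k) => χ^2 = 1)).card : ℝ) ≤ 4 := by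
      exact_mod_cast count_real hp hk
    gcongr
  have hfin : 4 * ((k * Real.log p)^2 / (c^2 * p)) ≤ (8000 / c^2) * k^2 * (Real.log p)^2 * q2 / p := by
    have e : (8000 / c^2) * k^2 * (Real.log p)^2 * q2 / p = ((k * Real.log p)^2 / (c^2 * p)) * (8000 * q2) := by
      field_simp
    rw [e, mul_comm]
    exact mul_le_mul_of_nonneg_left (by linarith) (by positivity)
  rw [hsplit, add_sub_right_comm]
  refine (abs_add_le _ _).trans ((add_le_add h1 hRs).trans ?_)
  have hpos1 : 0 ≤ (8000 / c^2) * (1/Real.log p) := by positivity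
  have hpos2 : 0 ≤ C1 * k^2 * (Real.log p)^2 * q2 / p := by positivity
  have e1 : (C1 + 8000/c^2) * k^2 * (Real.log p)^2 * q2 / p =
    C1 * k^2 * (Real.log p)^2 * q2 / p + (8000/c^2) * k^2 * (Real.log p)^2 * q2 / p := by ring
  have e2 : (C1 + 8000/c^2) * (1/Real.log p) = C1 * (1/Real.log p) + (8000/c^2) * (1/Real.log p) := by ring
  rw [e1, e2]
  linarith

end NSM

open scoped Classical in
/-- There are constants `c0 > 0` (the zero-free-region constant) and `C > 0`
such that for every prime `p` and `k ≥ 1` with `q = p^k`, if no nonprincipal Dirichlet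
character mod `q` has a real zero `β ≥ 1 - c0 / log q`, then
`|Σ_{χ ≠ χ0, χ even} (f_χ |L(1,χ)|²)⁻¹ − (ζ(2)/(2ζ(4))) ((p−1)²/(p²+1)) k|
  ≤ C / log p + C k² (log p)² (log k + log log p)² / p`. -/
theorem negative_square_moment_with_conductor :
    ∃ c0 > (0 : ℝ), ∃ C > (0 : ℝ), ∀ (p k : ℕ) (hp : p.Prime) (_hk : 1 ≤ k),
      haveI : NeZero (p ^ k) := ⟨pow_ne_zero k (hp.ne_zero)⟩
      (∀ χ : DirichletCharacter ℂ (p ^ k), χ ≠ 1 → ∀ β : ℝ,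
          1 - c0 / Real.log (p ^ k : ℕ) ≤ β → χ.LFunction (β : ℂ) ≠ 0) →
      |(∑ χ : DirichletCharacter ℂ (p ^ k),
          if χ ≠ 1 ∧ χ.Even then 1 / ((χ.conductor : ℝ) * ‖χ.LFunction 1‖ ^ 2) else 0) -
        (riemannZeta 2 / (2 * riemannZeta 4)).re *
          (((p : ℝ) - 1) ^ 2 / ((p : ℝ) ^ 2 + 1)) * k| ≤
      C * (1 / Real.log p) +
        C * k ^ 2 * (Real.log p) ^ 2 * (Real.log k + Real.log (Real.log p)) ^ 2 / p := by
  obtain ⟨c0, hc0, C, hC, h⟩ := NSM.final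
  refine ⟨c0, hc0, C, hC, fun p k hp hk => ?_⟩
  have hN : ∀ j, NeZero (p ^ j) := fun j => ⟨pow_ne_zero j hp.ne_zero⟩
  exact h p k hp hk
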